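/- arXiv:1205.1735 — 2 statements merged into one kernel-verified Lean document; each statement's English description precedes it below -/
import Mathlib

section
/- Let α ∈ ℝ, γ ∈ (1/2,1], let w : [0,1] → ℝ^d be continuous with K^w_{α,γ} < ∞, let b ∈ FL^{α+2} and x₀ ∈ ℝ^d. Then the Young equation θ_t = x₀ + ∫₀^t (σ^w_{du} b)(θ_u), t ∈ [0,1], has exactly one solution θ ∈ C^{0,γ}([0,1], ℝ^d) with θ₀ = x₀. -/
open MeasureTheory Filter Topology
open scoped ENNReal NNReal

noncomputable section

abbrev Euc (d : ℕ) : Type := EuclideanSpace ℝ (Fin d)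

/-- `Y^w_{s,t}(ω,ξ) = ∫_s^t exp(i ξ·w_u + i ω u) du`. -/
def Yint {d : ℕ} (w : ℝ → Euc d) (s t ω : ℝ) (ξ : Euc d) : ℂ :=
  ∫ u in s..t, Complex.exp (Complex.I * Complex.ofReal (inner ℝ ξ (w u) + ω * u))

/-- The averaging constant `K^w_{α,γ}`. -/
def avgK {d : ℕ} (w : ℝ → Euc d) (α γ : ℝ) : ℝ≥0∞ :=
  ⨆ (s : ℝ) (t : ℝ) (_ : 0 ≤ s) (_ : s < t) (_ : t ≤ 1) (ω : ℝ) (ξ : Euc d),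
    ENNReal.ofReal (‖Yint w s t ω ξ‖ /
      ((1 + ‖ξ‖) ^ α * (1 + Real.sqrt (Real.log (1 + |ω|))) * (t - s) ^ γ))

/-- The norm `N_α` of a space-time vector field given through its Fourier transform `bhat`. -/
def FLnorm (d : ℕ) (α : ℝ) (bhat : ℝ × Euc d → Fin d → ℂ) : ℝ≥0∞ :=
  ∫⁻ p : ℝ × Euc d, ENNReal.ofReal (‖bhat p‖ * (1 + ‖p.2‖) ^ α *
    (1 + Real.sqrt (Real.log (1 + |p.1|))))

/-- The vector field `b(t,x)` recovered from its space-time Fourier transform. -/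
def fieldOf {d : ℕ} (bhat : ℝ × Euc d → Fin d → ℂ) (t : ℝ) (x : Euc d) : Euc d :=
  (EuclideanSpace.equiv (Fin d) ℝ).symm fun i =>
    ∫ p : ℝ × Euc d, (bhat p i * Complex.exp (Complex.I * Complex.ofReal (p.1 * t + inner ℝ p.2 x))).re

/-- The averaged vector field `σ^w_{[s,t]} b`, defined through the Fourier representation. -/
def sigmaAvg {d : ℕ} (w : ℝ → Euc d) (bhat : ℝ × Euc d → Fin d → ℂ) (s t : ℝ) (x : Euc d) :
    Euc d :=
  (EuclideanSpace.equiv (Fin d) ℝ).symm fun i =>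
    ∫ p : ℝ × Euc d, (bhat p i * Yint w s t p.1 p.2 *
      Complex.exp (Complex.I * Complex.ofReal (inner ℝ p.2 x))).re

/-- Partitions of the interval `[s,t]`. -/
structure IntervalPartition (s t : ℝ) where
  n : ℕ
  pts : ℕ → ℝ
  first : pts 0 = s
  last : pts n = t
  mono : ∀ i, i < n → pts i ≤ pts (i + 1)

/-- The mesh of the partition is smaller than `δ`. -/
def IntervalPartition.MeshLt {s t : ℝ} (P : IntervalPartition s t) (δ : ℝ) : Prop :=
  ∀ i, i < P.n → P.pts (i + 1) - P.pts i < δ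

/-- Riemann sums `Σ_i (G_{t_{i+1}} - G_{t_i})(f_{t_i})` of the nonlinear Young integral. -/
def RiemannSum {V W : Type*} [AddCommGroup W] (G : ℝ → V → W) (f : ℝ → V)
    {s t : ℝ} (P : IntervalPartition s t) : W :=
  ∑ i ∈ Finset.range P.n, (G (P.pts (i + 1)) (f (P.pts i)) - G (P.pts i) (f (P.pts i)))

/-- `L` is the nonlinear Young integral `∫_s^t G_{du}(f_u)`: the Riemann sums converge to `L`
as the mesh of the partition tends to `0`. -/
def HasYoungIntegral {V W : Type*} [NormedAddCommGroup W] (G : ℝ → V → W) (f : ℝ → V)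
    (s t : ℝ) (L : W) : Prop :=
  ∀ ε > 0, ∃ δ > 0, ∀ P : IntervalPartition s t, P.MeshLt δ → ‖RiemannSum G f P - L‖ < ε

/-- Riemann sums `Σ_i (σ^w_{[t_i,t_{i+1}]} b)(θ_{t_i})`. -/
def sigmaRiemannSum {d : ℕ} (w : ℝ → Euc d) (bhat : ℝ × Euc d → Fin d → ℂ)
    (θ : ℝ → Euc d) {s t : ℝ} (P : IntervalPartition s t) : Euc d :=
  ∑ i ∈ Finset.range P.n, sigmaAvg w bhat (P.pts i) (P.pts (i + 1)) (θ (P.pts i))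

/-- `L = ∫_s^t (σ^w_{du} b)(θ_u)` as a limit of Riemann sums. -/
def HasSigmaIntegral {d : ℕ} (w : ℝ → Euc d) (bhat : ℝ × Euc d → Fin d → ℂ)
    (θ : ℝ → Euc d) (s t : ℝ) (L : Euc d) : Prop :=
  ∀ ε > 0, ∃ δ > 0, ∀ P : IntervalPartition s t, P.MeshLt δ → ‖sigmaRiemannSum w bhat θ P - L‖ < ε

/-- `θ` solves the Young equation `θ_t = x₀ + ∫_0^t (σ^w_{du} b)(θ_u)` on `[0,1]`. -/
def SolvesSigmaYoung {d : ℕ} (w : ℝ → Euc d) (bhat : ℝ × Euc d → Fin d → ℂ)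
    (x₀ : Euc d) (θ : ℝ → Euc d) : Prop :=
  θ 0 = x₀ ∧ ∀ t ∈ Set.Icc (0 : ℝ) 1, HasSigmaIntegral w bhat θ 0 t (θ t - x₀)

/-- `γ`-Hölder continuity on `[0,1]`. -/
def HolderOnIcc {E : Type*} [NormedAddCommGroup E] (γ : ℝ) (f : ℝ → E) : Prop :=
  ∃ C : ℝ, ∀ s ∈ Set.Icc (0 : ℝ) 1, ∀ t ∈ Set.Icc (0 : ℝ) 1, ‖f t - f s‖ ≤ C * |t - s| ^ γ

/-- Covariance of the fractional Brownian motion of Hurst index `H`. -/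
def fbmCov (H : ℝ) (s t : ℝ) : ℝ := (s ^ (2 * H) + t ^ (2 * H) - |t - s| ^ (2 * H)) / 2

/-- `W` is a `d`-dimensional fractional Brownian motion of Hurst parameter `H` with continuous
sample paths: the coordinates are independent centered Gaussian processes with the fBm
covariance, expressed by asking every finite linear combination to be Gaussian. -/
def IsFBM {Ω : Type*} [MeasureSpace Ω] (d : ℕ) (H : ℝ) (W : Ω → ℝ → Euc d) : Prop :=
  (∀ ω, ContinuousOn (W ω) (Set.Icc 0 1)) ∧
  (∀ t, Measurable fun ω => W ω t) ∧
  (∀ ω, W ω 0 = 0) ∧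
  ∀ (n : ℕ) (c : Fin n → ℝ) (t : Fin n → ℝ) (j : Fin n → Fin d),
    (∀ k, t k ∈ Set.Icc (0 : ℝ) 1) →
    Measure.map (fun ω => ∑ k, c k * W ω (t k) (j k)) (volume : Measure Ω) =
      ProbabilityTheory.gaussianReal 0
        (Real.toNNReal (∑ k, ∑ l, c k * c l *
          (if j k = j l then fbmCov H (t k) (t l) else 0)))

/-- `R^w_λ = (∫_0^1 exp(λ |w_u|²) du)^{1/λ}`. -/
def Rconst {d : ℕ} (lam : ℝ) (w : ℝ → Euc d) : ℝ≥0∞ :=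
  (∫⁻ u in Set.Icc (0 : ℝ) 1, ENNReal.ofReal (Real.exp (lam * ‖w u‖ ^ 2))) ^ (1 / lam)

/-- `S^w_λ`. -/
def Sconst {d : ℕ} (H lam : ℝ) (w : ℝ → Euc d) : ℝ≥0∞ :=
  (∑' n : ℕ, ∑' m : ℕ, ∑ k ∈ Finset.range (2 ^ n), ∑' q : ℤ × (Fin d → ℤ),
    ENNReal.ofReal (
      (2 : ℝ) ^ (-(2 * (n : ℝ)) - (m : ℝ) * ((d : ℝ) + 2)) *
      (1 + |(q.1 : ℝ) / 2 ^ m|) ^ (-(2 : ℝ)) *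
      (1 + ‖(EuclideanSpace.equiv (Fin d) ℝ).symm (fun i => (q.2 i : ℝ) / 2 ^ m)‖) ^
        (-((d : ℝ) + 1)) *
      Real.exp (lam * 2 ^ n *
        (1 + ‖(EuclideanSpace.equiv (Fin d) ℝ).symm (fun i => (q.2 i : ℝ) / 2 ^ m)‖) ^ (1 / H) *
        ‖Yint w ((k : ℝ) / 2 ^ n) (((k : ℝ) + 1) / 2 ^ n) ((q.1 : ℝ) / 2 ^ m)
          ((EuclideanSpace.equiv (Fin d) ℝ).symm (fun i => (q.2 i : ℝ) / 2 ^ m))‖ ^ 2))) ^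
  (1 / lam)

/-- `Q^w_λ = √(log S^w_λ) + √(log R^w_λ)`. -/
def Qconst {d : ℕ} (H lam : ℝ) (w : ℝ → Euc d) : ℝ :=
  Real.sqrt (Real.log (Sconst H lam w).toReal) + Real.sqrt (Real.log (Rconst lam w).toReal)

/-! ### Discrete and continuous sewing -/

/-- The constant of the sewing estimates with exponent `β > 1`. -/
def sewConst (β : ℝ) : ℝ := 2 / (1 - 2 ^ (1 - β))

theorem two_rpow_one_sub_lt_one {β : ℝ} (hβ : 1 < β) : (2 : ℝ) ^ (1 - β) < 1 :=
  Real.rpow_lt_one_of_one_lt_of_neg (by norm_num) (by linarith)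

theorem sewConst_pos {β : ℝ} (hβ : 1 < β) : 0 < sewConst β :=
  div_pos two_pos (sub_pos.2 (two_rpow_one_sub_lt_one hβ))

theorem sewConst_fixed {β : ℝ} (hβ : 1 < β) :
    2 ^ (1 - β) * sewConst β + 2 = sewConst β := by
  have h := two_rpow_one_sub_lt_one hβ
  have : (1 - (2 : ℝ) ^ (1 - β)) ≠ 0 := by linarith
  unfold sewConst
  field_simp
  ring

theorem two_mul_half_rpow {β x : ℝ} (hx : 0 ≤ x) :
    2 * (x / 2) ^ β = 2 ^ (1 - β) * x ^ β := by
  rw [Real.div_rpow hx (by norm_num), Real.rpow_sub (by norm_num), Real.rpow_one]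
  ring

/-- A monotone finite sequence crosses the middle of its range at some step. -/
theorem exists_crossing (p : ℕ → ℝ) (m : ℝ) {i j : ℕ} (hij : i < j) (hi : p i ≤ m)
    (hj : m ≤ p j) : ∃ k, i ≤ k ∧ k < j ∧ p k ≤ m ∧ m ≤ p (k + 1) := by
  induction j, hij using Nat.le_induction with
  | base => exact ⟨i, le_rfl, Nat.lt_succ_self i, hi, hj⟩
  | succ j hij ih =>
    by_cases h : m ≤ p j
    · obtain ⟨k, h1, h2, h3⟩ := ih h
      exact ⟨k, h1, by omega, h3⟩
    · exact ⟨j, by omega, by omega, (not_le.1 h).le, hj⟩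

/-- Sewing along a partition: an almost additive remainder which vanishes on the elementary
intervals is superlinearly small. -/
theorem discrete_sewing {β M : ℝ} (hβ : 1 < β) (hM : 0 ≤ M) (p : ℕ → ℝ) (r : ℕ → ℕ → ℝ) (a b : ℕ)
    (hp : ∀ i j, a ≤ i → i ≤ j → j ≤ b → p i ≤ p j)
    (h0 : ∀ i, r i i = 0)
    (h1 : ∀ i, a ≤ i → i + 1 ≤ b → r i (i + 1) = 0)
    (h2 : ∀ i j k, a ≤ i → i ≤ j → j ≤ k → k ≤ b →
      r i j ≤ sewConst β * M * (p j - p i) ^ β →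
      r i k ≤ r i j + r j k + M * (p k - p i) ^ β) :
    ∀ i j, a ≤ i → i ≤ j → j ≤ b → r i j ≤ sewConst β * M * (p j - p i) ^ β := by
  have hκ := sewConst_pos hβ
  suffices H : ∀ n i j, j - i = n → a ≤ i → i ≤ j → j ≤ b →
      r i j ≤ sewConst β * M * (p j - p i) ^ β from fun i j => H _ i j rfl
  intro n
  induction n using Nat.strong_induction_on with
  | _ n ih =>
  intro i j hn hai hij hjb
  have hL := sub_nonneg.2 (hp i j hai hij hjb)
  rcases hij.eq_or_lt with rfl | hlt
  · rw [h0]; positivity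
  obtain ⟨k, hik, hkj, hk1, hk2⟩ := exists_crossing p ((p i + p j) / 2) hlt
    (by linarith) (by linarith)
  have e1 := ih (k - i) (by omega) i k rfl hai hik (by omega)
  have e2 := ih (j - (k + 1)) (by omega) (k + 1) j rfl (by omega) (by omega) hjb
  have m1 := hp i k hai hik (by omega)
  have m2 := hp k (k + 1) (by omega) (by omega) (by omega)
  have m3 := hp (k + 1) j (by omega) (by omega) hjb
  have s1 := h2 i k j hai hik hkj.le hjb e1
  have s2 := h2 k (k + 1) j (by omega) (by omega) hkj hjb (by
    rw [h1 k (by omega) (by omega)]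
    have := sub_nonneg.2 m2
    positivity)
  rw [h1 k (by omega) (by omega)] at s2
  have g1 : (p k - p i) ^ β ≤ ((p j - p i) / 2) ^ β :=
    Real.rpow_le_rpow (by linarith) (by linarith) (by linarith)
  have g2 : (p j - p (k + 1)) ^ β ≤ ((p j - p i) / 2) ^ β :=
    Real.rpow_le_rpow (by linarith) (by linarith) (by linarith)
  have g3 : (p j - p k) ^ β ≤ (p j - p i) ^ β :=
    Real.rpow_le_rpow (by linarith) (by linarith) (by linarith)
  have hκM : 0 ≤ sewConst β * M := by positivity
  calc r i j ≤ sewConst β * M * ((p j - p i) / 2) ^ β + sewConst β * M * ((p j - p i) / 2) ^ β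
        + 2 * M * (p j - p i) ^ β := by
        have := mul_le_mul_of_nonneg_left g1 hκM
        have := mul_le_mul_of_nonneg_left g2 hκM
        have := mul_le_mul_of_nonneg_left g3 hM
        linarith
    _ = sewConst β * M * (2 * ((p j - p i) / 2) ^ β) + 2 * M * (p j - p i) ^ β := by ring
    _ = (2 ^ (1 - β) * sewConst β + 2) * M * (p j - p i) ^ β := by
        rw [two_mul_half_rpow hL]; ring
    _ = _ := by rw [sewConst_fixed hβ]

/-- Sewing by bisection: an almost additive remainder of superlinear order satisfies the sewing
bound, whatever its initial constant. -/
theorem bisection_sewing {β M B : ℝ} (hβ : 1 < β) (hM : 0 ≤ M) {a b : ℝ} (r : ℝ → ℝ → ℝ)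
    (hB : ∀ s t, a ≤ s → s ≤ t → t ≤ b → r s t ≤ B * (t - s) ^ β)
    (h2 : ∀ s u t, a ≤ s → s ≤ u → u ≤ t → t ≤ b → r s t ≤ r s u + r u t + M * (t - s) ^ β) :
    ∀ s t, a ≤ s → s ≤ t → t ≤ b → r s t ≤ sewConst β * M * (t - s) ^ β := by
  set q : ℝ := 2 ^ (1 - β) with hq
  have hq0 : 0 ≤ q := by positivity
  have hq1 : q < 1 := two_rpow_one_sub_lt_one hβ
  have key : ∀ n : ℕ, ∀ s t, a ≤ s → s ≤ t → t ≤ b →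
      r s t ≤ (q ^ n * B + sewConst β * M) * (t - s) ^ β := by
    intro n
    induction n with
    | zero =>
      intro s t h1 h3 h4
      have := sub_nonneg.2 h3
      have h5 : 0 ≤ sewConst β * M * (t - s) ^ β :=
        mul_nonneg (mul_nonneg (sewConst_pos hβ).le hM) (by positivity)
      have := hB s t h1 h3 h4
      rw [pow_zero]; linarith
    | succ n ih =>
      intro s t h1 h3 h4
      have hL := sub_nonneg.2 h3
      have e1 := ih s ((s + t) / 2) h1 (by linarith) (by linarith)
      have e2 := ih ((s + t) / 2) t (by linarith) (by linarith) h4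
      have e3 := h2 s ((s + t) / 2) t h1 (by linarith) (by linarith) h4
      rw [show (s + t) / 2 - s = (t - s) / 2 by ring] at e1
      rw [show t - (s + t) / 2 = (t - s) / 2 by ring] at e2
      have e4 := two_mul_half_rpow (β := β) hL
      have hMt : 0 ≤ M * (t - s) ^ β := by positivity
      calc r s t ≤ (q ^ n * B + sewConst β * M) * (2 * ((t - s) / 2) ^ β)
            + 2 * (M * (t - s) ^ β) := by linarith
        _ = (q ^ (n + 1) * B + (q * sewConst β + 2) * M) * (t - s) ^ β := by
            rw [e4]; ring
        _ = _ := by rw [hq, sewConst_fixed hβ]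
  intro s t h1 h3 h4
  refine ge_of_tendsto' (x := atTop) ?_ fun n => key n s t h1 h3 h4
  have := ((tendsto_pow_atTop_nhds_zero_of_lt_one hq0 hq1).mul_const B).add_const
    (sewConst β * M) |>.mul_const ((t - s) ^ β)
  simpa using this

/-! ### Nonlinear Young equations -/

theorem IntervalPartition.pts_le {s t : ℝ} (P : IntervalPartition s t) {i j : ℕ} (hij : i ≤ j)
    (hj : j ≤ P.n) : P.pts i ≤ P.pts j := by
  induction j, hij using Nat.le_induction with
  | base => exact le_rfl
  | succ j _ ih => exact (ih (by omega)).trans (P.mono j (by omega))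

theorem IntervalPartition.pts_mem_Icc {s t : ℝ} (P : IntervalPartition s t) {i : ℕ}
    (hi : i ≤ P.n) : P.pts i ∈ Set.Icc s t :=
  ⟨P.first.ge.trans (P.pts_le (Nat.zero_le i) hi), (P.pts_le hi le_rfl).trans P.last.le⟩

/-- Riemann sums of the two-parameter field `A` along `θ` converge to `L`. -/
def HasFieldIntegral {E : Type*} [NormedAddCommGroup E] (A : ℝ → ℝ → E → E) (θ : ℝ → E)
    (s t : ℝ) (L : E) : Prop :=
  ∀ ε > 0, ∃ δ > 0, ∀ P : IntervalPartition s t, P.MeshLt δ →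
    ‖∑ i ∈ Finset.range P.n, A (P.pts i) (P.pts (i + 1)) (θ (P.pts i)) - L‖ < ε

/-- An additive two-parameter field on `[0,1]`, `γ`-Hölder in time with values in the bounded
functions with bounded and Lipschitz derivative. -/
structure IsYoungField {E : Type*} [NormedAddCommGroup E] (A : ℝ → ℝ → E → E) (C γ : ℝ) :
    Prop where
  pos : 0 < C
  add : ∀ s u t x, 0 ≤ s → s ≤ u → u ≤ t → t ≤ 1 → A s t x = A s u x + A u t x
  bound : ∀ s t x, 0 ≤ s → s ≤ t → t ≤ 1 → ‖A s t x‖ ≤ C * (t - s) ^ γ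
  lip : ∀ s t x y, 0 ≤ s → s ≤ t → t ≤ 1 → ‖A s t x - A s t y‖ ≤ C * (t - s) ^ γ * ‖x - y‖
  lip_diff : ∀ s t x y x' y', 0 ≤ s → s ≤ t → t ≤ 1 →
    ‖A s t x - A s t y - A s t x' + A s t y'‖ ≤
      C * (t - s) ^ γ * (‖x - y - x' + y'‖ + ‖y - y'‖ * ‖x' - y'‖)

section YoungEquation

variable {E : Type*} [NormedAddCommGroup E] {A : ℝ → ℝ → E → E} {C γ : ℝ}

theorem IsYoungField.self_eq_zero (hA : IsYoungField A C γ) (hγ : 0 < γ) {s : ℝ} (hs : 0 ≤ s)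
    (hs1 : s ≤ 1) (x : E) : A s s x = 0 := by
  have := hA.bound s s x hs le_rfl hs1
  rw [sub_self, Real.zero_rpow hγ.ne', mul_zero] at this
  exact norm_le_zero_iff.1 this

theorem rpow_mul_rpow_le {γ s u t : ℝ} (hγ : 0 < γ) (h1 : s ≤ u) (h2 : u ≤ t) :
    (t - u) ^ γ * (u - s) ^ γ ≤ (t - s) ^ (2 * γ) := by
  rw [two_mul, Real.rpow_add_of_nonneg (by linarith) hγ.le hγ.le]
  exact mul_le_mul (Real.rpow_le_rpow (by linarith) (by linarith) hγ.le)
    (Real.rpow_le_rpow (by linarith) (by linarith) hγ.le)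
    (Real.rpow_nonneg (by linarith) _) (Real.rpow_nonneg (by linarith) _)

/-- The Riemann sum of a Hölder path along a partition is close to its first-order germ. -/
theorem IsYoungField.norm_sum_sub_le (hA : IsYoungField A C γ) (hγ : 1 / 2 < γ) {θ : ℝ → E}
    {H : ℝ} (hH : 0 ≤ H)
    (hθ : ∀ s t, 0 ≤ s → s ≤ t → t ≤ 1 → ‖θ t - θ s‖ ≤ H * (t - s) ^ γ) (p : ℕ → ℝ) (a b : ℕ)
    (hab : a ≤ b) (hp : ∀ i j, a ≤ i → i ≤ j → j ≤ b → p i ≤ p j) (ha : 0 ≤ p a) (hb : p b ≤ 1) :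
    ‖∑ i ∈ Finset.Ico a b, A (p i) (p (i + 1)) (θ (p i)) - A (p a) (p b) (θ (p a))‖ ≤
      sewConst (2 * γ) * (C * H) * (p b - p a) ^ (2 * γ) := by
  have hγ0 : 0 < γ := by linarith
  have hC := hA.pos
  have hmem : ∀ i, a ≤ i → i ≤ b → 0 ≤ p i ∧ p i ≤ 1 := fun i h1 h2 =>
    ⟨ha.trans (hp a i le_rfl h1 h2), (hp i b h1 h2 le_rfl).trans hb⟩
  let r : ℕ → ℕ → ℝ := fun i j => if i = j then 0 else
    ‖∑ l ∈ Finset.Ico i j, A (p l) (p (l + 1)) (θ (p l)) - A (p i) (p j) (θ (p i))‖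
  have hr : ∀ i j, a ≤ i → i ≤ j → j ≤ b →
      r i j = ‖∑ l ∈ Finset.Ico i j, A (p l) (p (l + 1)) (θ (p l)) - A (p i) (p j) (θ (p i))‖ := by
    intro i j h1 h2 h3
    by_cases h : i = j
    · subst h
      have := hmem i h1 h3
      simp [r, hA.self_eq_zero hγ0 this.1 this.2]
    · simp [r, h]
  rw [← hr a b le_rfl hab le_rfl]
  refine discrete_sewing (by linarith) (by positivity) p r a b hp (fun i => by simp [r]) ?_ ?_
    a b le_rfl hab le_rfl
  · intro i h1 h2
    rw [hr i (i + 1) h1 (by omega) h2]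
    simp
  · intro i j k h1 h2 h3 h4 _
    rw [hr i k h1 (by omega) h4, hr i j h1 h2 (by omega), hr j k (by omega) h3 h4]
    have mi := hmem i h1 (by omega)
    have mj := hmem j (by omega) (by omega)
    have mk := hmem k (by omega) h4
    have pij := hp i j h1 h2 (by omega)
    have pjk := hp j k (by omega) h3 h4
    rw [← Finset.sum_Ico_consecutive _ h2 h3, hA.add _ _ _ (θ (p i)) mi.1 pij pjk mk.2]
    have e1 : ‖A (p j) (p k) (θ (p j)) - A (p j) (p k) (θ (p i))‖ ≤
        C * H * (p k - p i) ^ (2 * γ) := by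
      calc _ ≤ C * (p k - p j) ^ γ * ‖θ (p j) - θ (p i)‖ := hA.lip _ _ _ _ mj.1 pjk mk.2
        _ ≤ C * (p k - p j) ^ γ * (H * (p j - p i) ^ γ) :=
          mul_le_mul_of_nonneg_left (hθ _ _ mi.1 pij mj.2)
            (mul_nonneg hC.le (Real.rpow_nonneg (by linarith) _))
        _ = C * H * ((p k - p j) ^ γ * (p j - p i) ^ γ) := by ring
        _ ≤ _ := mul_le_mul_of_nonneg_left (rpow_mul_rpow_le hγ0 pij pjk) (by positivity)
    refine le_trans (le_of_eq (congrArg norm ?_)) (norm_add_le_of_le (norm_add_le _ _) e1)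
    abel

/-- A Hölder path whose increments are the Young integrals satisfies the first-order expansion. -/
theorem IsYoungField.expansion_of_integral (hA : IsYoungField A C γ) (hγ : 1 / 2 < γ) {θ : ℝ → E}
    {H : ℝ} (hH : 0 ≤ H) {x₀ : E}
    (hθ : ∀ s t, 0 ≤ s → s ≤ t → t ≤ 1 → ‖θ t - θ s‖ ≤ H * (t - s) ^ γ)
    (hI : ∀ t ∈ Set.Icc (0 : ℝ) 1, HasFieldIntegral A θ 0 t (θ t - x₀)) {s t : ℝ} (hs : 0 ≤ s)
    (hst : s ≤ t) (ht : t ≤ 1) :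
    ‖θ t - θ s - A s t (θ s)‖ ≤ sewConst (2 * γ) * (C * H) * (t - s) ^ (2 * γ) := by
  refine le_of_forall_pos_le_add fun ε hε => ?_
  obtain ⟨δ₁, hδ₁, h₁⟩ := hI s ⟨hs, hst.trans ht⟩ (ε / 2) (by linarith)
  obtain ⟨δ₂, hδ₂, h₂⟩ := hI t ⟨hs.trans hst, ht⟩ (ε / 2) (by linarith)
  obtain ⟨N, hN⟩ := exists_nat_gt (1 / min δ₁ δ₂)
  have hδ : 0 < min δ₁ δ₂ := lt_min hδ₁ hδ₂
  have hN0 : (0 : ℝ) < N := lt_trans (by positivity) hN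
  have hNδ : 1 / (N : ℝ) < min δ₁ δ₂ := by
    rw [div_lt_iff₀ hδ] at hN
    rw [div_lt_iff₀ hN0]; linarith
  have hδ₁' := hNδ.trans_le (min_le_left _ _)
  have hδ₂' := hNδ.trans_le (min_le_right _ _)
  let p : ℕ → ℝ := fun i => s * ((min i N : ℕ) : ℝ) / N + (t - s) * ((i - N : ℕ) : ℝ) / N
  have hstep : ∀ i, p i ≤ p (i + 1) ∧ p (i + 1) - p i ≤ 1 / N := by
    intro i
    by_cases h : i < N
    · have : p (i + 1) - p i = s / N := by
        simp only [p, min_eq_left h.le, min_eq_left (Nat.succ_le_of_lt h),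
          Nat.sub_eq_zero_of_le h.le, Nat.sub_eq_zero_of_le (Nat.succ_le_of_lt h)]
        push_cast; ring
      have h3 : 0 ≤ s / N := by positivity
      have h4 : s / N ≤ 1 / N := div_le_div_of_nonneg_right (by linarith) hN0.le
      constructor <;> linarith
    · have h' : N ≤ i := not_lt.1 h
      have : p (i + 1) - p i = (t - s) / N := by
        simp only [p, min_eq_right h', min_eq_right (h'.trans i.le_succ),
          Nat.sub_add_comm h']
        push_cast; ring
      have h3 : 0 ≤ (t - s) / N := div_nonneg (by linarith) hN0.le
      have h4 : (t - s) / N ≤ 1 / N := div_le_div_of_nonneg_right (by linarith) hN0.le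
      constructor <;> linarith
  have hp0 : p 0 = 0 := by simp [p]
  have hpN : p N = s := by simp [p, hN0.ne']
  have hp2 : p (N + N) = t := by
    simp only [p, min_eq_right (Nat.le_add_left N N), Nat.add_sub_cancel]
    field_simp; ring
  have g₁ := h₁ ⟨N, p, hp0, hpN, fun i _ => (hstep i).1⟩
    fun i _ => (hstep i).2.trans_lt hδ₁'
  have g₂ := h₂ ⟨N + N, p, hp0, hp2, fun i _ => (hstep i).1⟩
    fun i _ => (hstep i).2.trans_lt hδ₂'
  have g₃ := hA.norm_sum_sub_le hγ hH hθ p N (N + N) (Nat.le_add_left _ _)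
    (fun i j _ hij _ => monotone_nat_of_le_succ (fun i => (hstep i).1) hij)
    (hpN.symm ▸ hs) (hp2.symm ▸ ht)
  dsimp only at g₁ g₂
  rw [hpN, hp2] at g₃
  rw [← Finset.sum_range_add_sum_Ico _ (Nat.le_add_left N N)] at g₂
  have : θ t - θ s - A s t (θ s) =
      (∑ i ∈ Finset.Ico N (N + N), A (p i) (p (i + 1)) (θ (p i)) - A s t (θ s))
      + (∑ i ∈ Finset.range N, A (p i) (p (i + 1)) (θ (p i)) - (θ s - x₀))
      - (∑ i ∈ Finset.range N, A (p i) (p (i + 1)) (θ (p i)) +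
        ∑ i ∈ Finset.Ico N (N + N), A (p i) (p (i + 1)) (θ (p i)) - (θ t - x₀)) := by abel
  rw [this]
  refine (norm_sub_le _ _).trans ?_
  have := norm_add_le (∑ i ∈ Finset.Ico N (N + N), A (p i) (p (i + 1)) (θ (p i)) - A s t (θ s))
    (∑ i ∈ Finset.range N, A (p i) (p (i + 1)) (θ (p i)) - (θ s - x₀))
  linarith

/-- For `c > 0` and any `K`, some time scale `T ≤ 1` has `K * T ^ γ ≤ c`. -/
theorem exists_small_scale {γ c : ℝ} (hγ : 0 < γ) (hc : 0 < c) (K : ℝ) :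
    ∃ T : ℝ, 0 < T ∧ T ≤ 1 ∧ K * T ^ γ ≤ c := by
  have h : Tendsto (fun T : ℝ => K * T ^ γ) (𝓝[>] 0) (𝓝 0) := by
    have : ContinuousAt (fun T : ℝ => K * T ^ γ) 0 :=
      continuousAt_const.mul (Real.continuousAt_rpow_const 0 γ (Or.inr hγ.le))
    have h2 := this.tendsto.mono_left (nhdsWithin_le_nhds (s := Set.Ioi 0))
    simpa [Real.zero_rpow hγ.ne'] using h2
  obtain ⟨T, h1, h2⟩ := ((h.eventually (ge_mem_nhds hc)).and
    (Ioc_mem_nhdsGT (zero_lt_one' ℝ))).exists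
  exact ⟨T, h2.1, h2.2, h1⟩

/-- A path satisfying the first-order expansion has the Young integrals as increments. -/
theorem hasFieldIntegral_of_expansion {β B T : ℝ} (hβ : 1 < β) (hB : 0 ≤ B) (hT : 0 < T)
    {θ : ℝ → E}
    (h : ∀ s t, 0 ≤ s → s ≤ t → t ≤ 1 → t - s ≤ T →
      ‖θ t - θ s - A s t (θ s)‖ ≤ B * (t - s) ^ β) {t : ℝ} (ht : t ≤ 1) :
    HasFieldIntegral A θ 0 t (θ t - θ 0) := by
  intro ε hε
  obtain ⟨δ, hδ, -, hδε⟩ := exists_small_scale (γ := β - 1) (c := ε / 2) (by linarith)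
    (by linarith) B
  refine ⟨min δ T, lt_min hδ hT, fun P hP => ?_⟩
  have h0 : ∀ i, i ≤ P.n → 0 ≤ P.pts i := fun i hi => (P.pts_mem_Icc hi).1
  have h1 : ∀ i, i ≤ P.n → P.pts i ≤ 1 := fun i hi => (P.pts_mem_Icc hi).2.trans ht
  have htel : θ t - θ 0 = ∑ i ∈ Finset.range P.n, (θ (P.pts (i + 1)) - θ (P.pts i)) := by
    rw [Finset.sum_range_sub (fun i => θ (P.pts i)), P.first, P.last]
  rw [htel, ← Finset.sum_sub_distrib]
  have hterm : ∀ i ∈ Finset.range P.n, ‖A (P.pts i) (P.pts (i + 1)) (θ (P.pts i)) -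
      (θ (P.pts (i + 1)) - θ (P.pts i))‖ ≤ ε / 2 * (P.pts (i + 1) - P.pts i) := by
    intro i hi
    have hi := Finset.mem_range.1 hi
    have hm := P.mono i hi
    have hd := hP i hi
    rw [norm_sub_rev]
    refine (h _ _ (h0 i hi.le) hm (h1 _ hi) (hd.le.trans (min_le_right _ _))).trans ?_
    have hL := sub_nonneg.2 hm
    rcases hL.eq_or_lt with h3 | h3
    · rw [← h3, Real.zero_rpow (by linarith)]; simp
    calc B * (P.pts (i + 1) - P.pts i) ^ β
        = B * (P.pts (i + 1) - P.pts i) ^ (β - 1) * (P.pts (i + 1) - P.pts i) := by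
          rw [mul_assoc, ← Real.rpow_add_one h3.ne', sub_add_cancel]
      _ ≤ B * δ ^ (β - 1) * (P.pts (i + 1) - P.pts i) := by
          refine mul_le_mul_of_nonneg_right (mul_le_mul_of_nonneg_left ?_ hB) hL
          exact Real.rpow_le_rpow hL (hd.le.trans (min_le_left _ _)) (by linarith)
      _ ≤ _ := mul_le_mul_of_nonneg_right hδε hL
  refine ((norm_sum_le _ _).trans (Finset.sum_le_sum hterm)).trans_lt ?_
  rw [← Finset.mul_sum, Finset.sum_range_sub (fun i => P.pts i), P.first, P.last, sub_zero]
  nlinarith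

/-- On short intervals the Hölder constant of the difference of two solutions which agree at the
left end can be halved. -/
theorem IsYoungField.halve_holder_const (hA : IsYoungField A C γ) (hγ : 1 / 2 < γ) {θ ψ : ℝ → E}
    {H B T N a b : ℝ} (hH : 0 ≤ H) (hN : 0 ≤ N) (hT : 0 < T) (hT1 : T ≤ 1)
    (hTs : (C + sewConst (2 * γ) * (C * (1 + H))) * T ^ γ ≤ 1 / 2)
    (hψ : ∀ s t, 0 ≤ s → s ≤ t → t ≤ 1 → ‖ψ t - ψ s‖ ≤ H * (t - s) ^ γ)
    (eθ : ∀ s t, 0 ≤ s → s ≤ t → t ≤ 1 → ‖θ t - θ s - A s t (θ s)‖ ≤ B * (t - s) ^ (2 * γ))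
    (eψ : ∀ s t, 0 ≤ s → s ≤ t → t ≤ 1 → ‖ψ t - ψ s - A s t (ψ s)‖ ≤ B * (t - s) ^ (2 * γ))
    (ha : 0 ≤ a) (hb : b ≤ 1) (hab : b - a ≤ T) (h0 : θ a = ψ a)
    (hD : ∀ s t, a ≤ s → s ≤ t → t ≤ b → ‖θ t - ψ t - (θ s - ψ s)‖ ≤ N * (t - s) ^ γ) :
    ∀ s t, a ≤ s → s ≤ t → t ≤ b → ‖θ t - ψ t - (θ s - ψ s)‖ ≤ N / 2 * (t - s) ^ γ := by
  have hγ0 : 0 < γ := by linarith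
  have hC := hA.pos
  have hsup : ∀ u, a ≤ u → u ≤ b → ‖θ u - ψ u‖ ≤ N * T ^ γ := by
    intro u h1 h2
    have := hD a u le_rfl h1 h2
    rw [h0, sub_self, sub_zero] at this
    exact this.trans (mul_le_mul_of_nonneg_left
      (Real.rpow_le_rpow (by linarith) (by linarith) hγ0.le) hN)
  have hsup1 : ∀ u, a ≤ u → u ≤ b → ‖θ u - ψ u‖ ≤ N := fun u h1 h2 =>
    (hsup u h1 h2).trans (mul_le_of_le_one_right hN (Real.rpow_le_one hT.le hT1 hγ0.le))
  have key := bisection_sewing (β := 2 * γ) (M := C * (1 + H) * N) (B := B + B) (a := a) (b := b)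
    (by linarith) (by positivity)
    (fun s t => ‖θ t - ψ t - (θ s - ψ s) - (A s t (θ s) - A s t (ψ s))‖) ?_ ?_
  · intro s t h1 h2 h3
    have hL : 0 ≤ t - s := by linarith
    have hLγ : 0 ≤ (t - s) ^ γ := by positivity
    have e1 := key s t h1 h2 h3
    have e2 := (hA.lip s t (θ s) (ψ s) (by linarith) h2 (by linarith)).trans
      (mul_le_mul_of_nonneg_left (hsup s h1 (by linarith)) (by positivity))
    have e3 : (t - s) ^ (2 * γ) ≤ (t - s) ^ γ * T ^ γ := by
      rw [two_mul, Real.rpow_add_of_nonneg hL hγ0.le hγ0.le]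
      exact mul_le_mul_of_nonneg_left (Real.rpow_le_rpow hL (by linarith) hγ0.le) hLγ
    have e4 := norm_add_le (θ t - ψ t - (θ s - ψ s) - (A s t (θ s) - A s t (ψ s)))
      (A s t (θ s) - A s t (ψ s))
    rw [sub_add_cancel] at e4
    have hκ := sewConst_pos (β := 2 * γ) (by linarith)
    calc _ ≤ sewConst (2 * γ) * (C * (1 + H) * N) * ((t - s) ^ γ * T ^ γ)
          + C * (t - s) ^ γ * (N * T ^ γ) :=
          e4.trans (add_le_add (e1.trans (mul_le_mul_of_nonneg_left e3 (by positivity))) e2)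
      _ = ((C + sewConst (2 * γ) * (C * (1 + H))) * T ^ γ) * (N * (t - s) ^ γ) := by ring
      _ ≤ 1 / 2 * (N * (t - s) ^ γ) := mul_le_mul_of_nonneg_right hTs (by positivity)
      _ = _ := by ring
  · intro s t h1 h2 h3
    have e1 := eθ s t (by linarith) h2 (by linarith)
    have e2 := eψ s t (by linarith) h2 (by linarith)
    have : θ t - ψ t - (θ s - ψ s) - (A s t (θ s) - A s t (ψ s)) =
      (θ t - θ s - A s t (θ s)) - (ψ t - ψ s - A s t (ψ s)) := by abel
    rw [this, add_mul]
    exact (norm_sub_le _ _).trans (add_le_add e1 e2)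
  · intro s u t h1 h2 h3 h4
    have e1 := hA.lip_diff u t (θ s) (ψ s) (θ u) (ψ u) (by linarith) h3 (by linarith)
    have e2 : ‖θ s - ψ s - θ u + ψ u‖ ≤ N * (u - s) ^ γ := by
      have := hD s u h1 h2 (by linarith)
      rw [norm_sub_rev] at this
      rwa [show θ s - ψ s - θ u + ψ u = θ s - ψ s - (θ u - ψ u) by abel]
    have e3 : ‖ψ s - ψ u‖ * ‖θ u - ψ u‖ ≤ H * (u - s) ^ γ * N := by
      refine mul_le_mul ?_ (hsup1 u (by linarith) (by linarith)) (norm_nonneg _) ?_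
      · rw [norm_sub_rev]; exact hψ s u (by linarith) h2 (by linarith)
      · exact mul_nonneg hH (Real.rpow_nonneg (by linarith) _)
    have e4 : ‖A u t (θ s) - A u t (ψ s) - A u t (θ u) + A u t (ψ u)‖ ≤
        C * (1 + H) * N * (t - s) ^ (2 * γ) := by
      calc _ ≤ C * (t - u) ^ γ * (N * (u - s) ^ γ + H * (u - s) ^ γ * N) :=
            e1.trans (mul_le_mul_of_nonneg_left (add_le_add e2 e3)
              (mul_nonneg hC.le (Real.rpow_nonneg (by linarith) _)))
        _ = C * (1 + H) * N * ((t - u) ^ γ * (u - s) ^ γ) := by ring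
        _ ≤ _ := mul_le_mul_of_nonneg_left (rpow_mul_rpow_le hγ0 h2 h3) (by positivity)
    rw [hA.add s u t (θ s) (by linarith) h2 h3 (by linarith),
      hA.add s u t (ψ s) (by linarith) h2 h3 (by linarith)]
    refine le_trans (le_of_eq (congrArg norm ?_)) (norm_sub_le_of_le (norm_add_le _ _) e4)
    abel

/-- Two Hölder paths with the first-order expansion and the same initial value coincide. -/
theorem IsYoungField.eq_of_expansion (hA : IsYoungField A C γ) (hγ : 1 / 2 < γ) {θ ψ : ℝ → E}
    {H B : ℝ} (hH : 0 ≤ H)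
    (hθ : ∀ s t, 0 ≤ s → s ≤ t → t ≤ 1 → ‖θ t - θ s‖ ≤ H * (t - s) ^ γ)
    (hψ : ∀ s t, 0 ≤ s → s ≤ t → t ≤ 1 → ‖ψ t - ψ s‖ ≤ H * (t - s) ^ γ)
    (eθ : ∀ s t, 0 ≤ s → s ≤ t → t ≤ 1 → ‖θ t - θ s - A s t (θ s)‖ ≤ B * (t - s) ^ (2 * γ))
    (eψ : ∀ s t, 0 ≤ s → s ≤ t → t ≤ 1 → ‖ψ t - ψ s - A s t (ψ s)‖ ≤ B * (t - s) ^ (2 * γ))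
    (h0 : θ 0 = ψ 0) : ∀ t, 0 ≤ t → t ≤ 1 → θ t = ψ t := by
  obtain ⟨T, hT, hT1, hTs⟩ := exists_small_scale (γ := γ) (c := 1 / 2) (by linarith)
    (by norm_num) (C + sewConst (2 * γ) * (C * (1 + H)))
  have hlocal : ∀ a b, 0 ≤ a → a ≤ b → b ≤ 1 → b - a ≤ T → θ a = ψ a → θ b = ψ b := by
    intro a b ha hab hb hT' hab0
    have hn : ∀ n : ℕ, ∀ s t, a ≤ s → s ≤ t → t ≤ b →
        ‖θ t - ψ t - (θ s - ψ s)‖ ≤ (H + H) * (1 / 2) ^ n * (t - s) ^ γ := by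
      intro n
      induction n with
      | zero =>
        intro s t h1 h2 h3
        rw [pow_zero, mul_one, add_mul, sub_sub_sub_comm]
        exact (norm_sub_le _ _).trans (add_le_add (hθ s t (by linarith) h2 (by linarith))
          (hψ s t (by linarith) h2 (by linarith)))
      | succ n ih =>
        have := hA.halve_holder_const hγ hH (by positivity) hT hT1 hTs hψ eθ eψ ha hb hT' hab0 ih
        intro s t h1 h2 h3
        refine (this s t h1 h2 h3).trans (le_of_eq ?_)
        ring
    have hlim : Tendsto (fun n : ℕ => (H + H) * (1 / 2 : ℝ) ^ n * (b - a) ^ γ) atTop (𝓝 0) := by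
      have := ((tendsto_pow_atTop_nhds_zero_of_lt_one (r := (1 / 2 : ℝ)) (by norm_num)
        (by norm_num)).const_mul (H + H)).mul_const ((b - a) ^ γ)
      simpa using this
    have := ge_of_tendsto' hlim fun n => hn n a b le_rfl hab le_rfl
    rw [hab0, sub_self, sub_zero] at this
    exact sub_eq_zero.1 (norm_le_zero_iff.1 this)
  have hind : ∀ k : ℕ, ∀ t, 0 ≤ t → t ≤ 1 → t ≤ k * T → θ t = ψ t := by
    intro k
    induction k with
    | zero =>
      intro t h1 _ h3
      have : t = 0 := le_antisymm (by simpa using h3) h1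
      rw [this, h0]
    | succ k ih =>
      intro t h1 h2 h3
      push_cast at h3
      by_cases h : t ≤ T
      · exact hlocal 0 t le_rfl h1 h2 (by linarith) h0
      · exact hlocal (t - T) t (by linarith) (by linarith) h2 (by linarith)
          (ih (t - T) (by linarith) (by linarith) (by linarith))
  intro t h1 h2
  obtain ⟨k, hk⟩ := exists_nat_gt (1 / T)
  rw [div_lt_iff₀ hT] at hk
  exact hind k t h1 h2 (by linarith)

/-- Local bounds on increments add up to a global one. -/
theorem norm_sub_le_of_local {f : ℝ → E} {K T : ℝ} (hT : 0 < T) (hK : 0 ≤ K)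
    (h : ∀ s t, 0 ≤ s → s ≤ t → t ≤ 1 → t - s ≤ T → ‖f t - f s‖ ≤ K) :
    ∀ s t, 0 ≤ s → s ≤ t → t ≤ 1 → ‖f t - f s‖ ≤ (⌈1 / T⌉₊ : ℝ) * K := by
  have hind : ∀ k : ℕ, ∀ s t, 0 ≤ s → s ≤ t → t ≤ 1 → t - s ≤ k * T → ‖f t - f s‖ ≤ k * K := by
    intro k
    induction k with
    | zero =>
      intro s t _ h2 _ h4
      have : t = s := le_antisymm (by simpa using h4) h2
      simp [this]
    | succ k ih =>
      intro s t h1 h2 h3 h4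
      push_cast at h4 ⊢
      by_cases hst : t - s ≤ T
      · have : 0 ≤ k * K := by positivity
        linarith [h s t h1 h2 h3 hst]
      · have e1 := ih s (t - T) h1 (by linarith) (by linarith) (by linarith)
        have e2 := h (t - T) t (by linarith) (by linarith) h3 (by linarith)
        have e3 := norm_add_le (f t - f (t - T)) (f (t - T) - f s)
        rw [sub_add_sub_cancel] at e3
        linarith
  intro s t h1 h2 h3
  refine hind _ s t h1 h2 h3 ?_
  have := Nat.le_ceil (1 / T)
  rw [div_le_iff₀ hT] at this
  linarith

theorem holder_of_local {f : ℝ → E} {K T : ℝ} (hγ : 0 ≤ γ) (hT : 0 < T) (hK : 0 ≤ K)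
    (h : ∀ s t, 0 ≤ s → s ≤ t → t ≤ 1 → t - s ≤ T → ‖f t - f s‖ ≤ K * (t - s) ^ γ) :
    HolderOnIcc γ f := by
  have hglob := norm_sub_le_of_local hT hK fun s t h1 h2 h3 h4 => (h s t h1 h2 h3 h4).trans
    (mul_le_of_le_one_right hK (Real.rpow_le_one (by linarith) (by linarith) hγ))
  have hTγ : 0 < T ^ γ := by positivity
  have hle : ∀ s t, 0 ≤ s → s ≤ t → t ≤ 1 →
      ‖f t - f s‖ ≤ (K + ⌈1 / T⌉₊ * K / T ^ γ) * (t - s) ^ γ := by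
    intro s t h1 h2 h3
    have hL : 0 ≤ t - s := by linarith
    rw [add_mul]
    by_cases hst : t - s ≤ T
    · exact (h s t h1 h2 h3 hst).trans (le_add_of_nonneg_right (by positivity))
    · refine (hglob s t h1 h2 h3).trans (le_add_of_nonneg_of_le (by positivity) ?_)
      rw [div_mul_eq_mul_div, le_div_iff₀ hTγ]
      exact mul_le_mul_of_nonneg_left (Real.rpow_le_rpow hT.le (not_le.1 hst).le hγ)
        (by positivity)
  refine ⟨K + ⌈1 / T⌉₊ * K / T ^ γ, fun s hs t ht => ?_⟩
  rcases le_total s t with hst | hst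
  · rw [abs_of_nonneg (by linarith)]; exact hle s t hs.1 hst ht.2
  · rw [norm_sub_rev, abs_sub_comm, abs_of_nonneg (by linarith)]; exact hle t s ht.1 hst hs.2

/-- The Euler scheme with step `1 / n` for the field `A`. -/
def eulerScheme (A : ℝ → ℝ → E → E) (x₀ : E) (n : ℕ) : ℕ → E
  | 0 => x₀
  | k + 1 => eulerScheme A x₀ n k + A (k / n) ((k + 1 : ℕ) / n) (eulerScheme A x₀ n k)

theorem IsYoungField.eulerScheme_expansion (hA : IsYoungField A C γ) (hγ : 1 / 2 < γ) {T : ℝ}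
    (hTs : sewConst (2 * γ) * (2 * C ^ 2) * T ^ γ ≤ C) (x₀ : E) {n : ℕ} (hn : 0 < n)
    {i j : ℕ} (hij : i ≤ j) (hjn : j ≤ n) (hT : (j / n : ℝ) - i / n ≤ T) :
    ‖eulerScheme A x₀ n j - eulerScheme A x₀ n i - A (i / n) (j / n) (eulerScheme A x₀ n i)‖ ≤
      sewConst (2 * γ) * (2 * C ^ 2) * ((j / n : ℝ) - i / n) ^ (2 * γ) := by
  have hγ0 : 0 < γ := by linarith
  have hC := hA.pos
  have hn' : (0 : ℝ) < n := by exact_mod_cast hn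
  have hpm : ∀ k l : ℕ, k ≤ l → (k / n : ℝ) ≤ l / n := fun k l h =>
    div_le_div_of_nonneg_right (by exact_mod_cast h) hn'.le
  have hp0 : ∀ k : ℕ, 0 ≤ (k / n : ℝ) := fun k => by positivity
  have hp1 : ∀ k : ℕ, k ≤ n → (k / n : ℝ) ≤ 1 := fun k h =>
    (div_le_one hn').2 (by exact_mod_cast h)
  set y := eulerScheme A x₀ n with hy
  let r : ℕ → ℕ → ℝ := fun k l => if k = l then 0 else ‖y l - y k - A (k / n) (l / n) (y k)‖
  have hr : ∀ k l : ℕ, k ≤ l → l ≤ n → r k l = ‖y l - y k - A (k / n) (l / n) (y k)‖ := by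
    intro k l h1 h2
    by_cases h : k = l
    · subst h
      simp [r, hA.self_eq_zero hγ0 (hp0 k) (hp1 k h2)]
    · simp [r, h]
  rw [← hr i j hij hjn]
  refine discrete_sewing (by linarith) (by positivity) (fun k : ℕ => (k / n : ℝ)) r i j
    (fun k l _ h _ => hpm k l h) (fun k => by simp [r]) ?_ ?_ i j le_rfl hij le_rfl
  · intro k h1 h2
    rw [hr k (k + 1) k.le_succ (by omega)]
    simp [hy, eulerScheme]
  · intro k l m h1 h2 h3 h4 h5
    rw [hr k l h2 (by omega)] at h5 ⊢
    rw [hr k m (by omega) (by omega), hr l m h3 (by omega)]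
    have pkl := hpm k l h2
    have plm := hpm l m h3
    have pik := hpm i k h1
    have pmj := hpm m j h4
    have hL : 0 ≤ (l / n : ℝ) - k / n := by linarith
    have hLT : ((l / n : ℝ) - k / n) ^ γ ≤ T ^ γ := Real.rpow_le_rpow hL (by linarith) hγ0.le
    have hLγ : 0 ≤ ((l / n : ℝ) - k / n) ^ γ := by positivity
    have hκ := sewConst_pos (β := 2 * γ) (by linarith)
    have e1 : ‖y l - y k‖ ≤ 2 * C * ((l / n : ℝ) - k / n) ^ γ := by
      have e := norm_add_le (y l - y k - A (k / n) (l / n) (y k)) (A (k / n) (l / n) (y k))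
      rw [sub_add_cancel] at e
      have e2 := hA.bound (k / n) (l / n) (y k) (hp0 k) pkl (hp1 l (by omega))
      have e3 : sewConst (2 * γ) * (2 * C ^ 2) * ((l / n : ℝ) - k / n) ^ (2 * γ) ≤
          C * ((l / n : ℝ) - k / n) ^ γ := by
        rw [two_mul γ, Real.rpow_add_of_nonneg hL hγ0.le hγ0.le, ← mul_assoc]
        refine mul_le_mul_of_nonneg_right ?_ hLγ
        rw [← two_mul]
        exact (mul_le_mul_of_nonneg_left hLT (by positivity)).trans hTs
      linarith
    have e2 : ‖A (l / n) (m / n) (y l) - A (l / n) (m / n) (y k)‖ ≤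
        2 * C ^ 2 * ((m / n : ℝ) - k / n) ^ (2 * γ) := by
      calc _ ≤ C * ((m / n : ℝ) - l / n) ^ γ * ‖y l - y k‖ :=
            hA.lip _ _ _ _ (hp0 l) plm (hp1 m (by omega))
        _ ≤ C * ((m / n : ℝ) - l / n) ^ γ * (2 * C * ((l / n : ℝ) - k / n) ^ γ) :=
          mul_le_mul_of_nonneg_left e1 (mul_nonneg hC.le (Real.rpow_nonneg (by linarith) _))
        _ = 2 * C ^ 2 * (((m / n : ℝ) - l / n) ^ γ * ((l / n : ℝ) - k / n) ^ γ) := by ring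
        _ ≤ _ := mul_le_mul_of_nonneg_left (rpow_mul_rpow_le hγ0 pkl plm) (by positivity)
    rw [hA.add _ _ _ (y k) (hp0 k) pkl plm (hp1 m (by omega))]
    refine le_trans (le_of_eq (congrArg norm ?_)) (norm_add_le_of_le (norm_add_le _ _) e2)
    abel

/-- Existence of a Hölder path with the first-order expansion, as a limit of Euler schemes. -/
theorem IsYoungField.exists_expansion [ProperSpace E] (hA : IsYoungField A C γ) (hγ : 1 / 2 < γ)
    (x₀ : E) : ∃ θ : ℝ → E, θ 0 = x₀ ∧ HolderOnIcc γ θ ∧ ∃ B T : ℝ, 0 ≤ B ∧ 0 < T ∧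
      ∀ s t, 0 ≤ s → s ≤ t → t ≤ 1 → t - s ≤ T →
        ‖θ t - θ s - A s t (θ s)‖ ≤ B * (t - s) ^ (2 * γ) := by
  have hγ0 : 0 < γ := by linarith
  have hC := hA.pos
  obtain ⟨T, hT, hT1, hTs⟩ := exists_small_scale (γ := γ) hγ0 hC (sewConst (2 * γ) * (2 * C ^ 2))
  have hκ := sewConst_pos (β := 2 * γ) (by linarith)
  set B := sewConst (2 * γ) * (2 * C ^ 2) with hBdef
  have hB : 0 ≤ B := by positivity
  let fl : ℕ → ℝ → ℝ := fun n t => (⌊t * n⌋₊ : ℝ) / n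
  let φ : ℕ → ℝ → E := fun n t => eulerScheme A x₀ n ⌊t * n⌋₊
  have fl_le : ∀ n : ℕ, 0 < n → ∀ t, 0 ≤ t → fl n t ≤ t := by
    intro n hn t ht
    have hn' : (0 : ℝ) < n := by exact_mod_cast hn
    exact (div_le_iff₀ hn').2 (Nat.floor_le (by positivity))
  have le_fl : ∀ n : ℕ, 0 < n → ∀ t, 0 ≤ t → t - 1 / n ≤ fl n t := by
    intro n hn t ht
    have hn' : (0 : ℝ) < n := by exact_mod_cast hn
    have h1 := Nat.lt_floor_add_one (t * n)
    rw [sub_le_iff_le_add, ← add_div, le_div_iff₀ hn']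
    exact h1.le
  have fl_lim : ∀ t, 0 ≤ t → Tendsto (fun n => fl n t) atTop (𝓝 t) := fun t ht =>
    (tendsto_nat_floor_mul_div_atTop ht).comp tendsto_natCast_atTop_atTop
  have step : ∀ n : ℕ, 0 < n → ∀ s t, 0 ≤ s → s ≤ t → t ≤ 1 → t - s ≤ T / 2 → 1 / (n : ℝ) ≤ T / 2 →
      0 ≤ fl n s ∧ fl n s ≤ fl n t ∧ fl n t - fl n s ≤ T ∧
      ‖φ n t - φ n s - A (fl n s) (fl n t) (φ n s)‖ ≤ B * (fl n t - fl n s) ^ (2 * γ) := by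
    intro n hn s t h1 h2 h3 h4 h5
    have hn' : (0 : ℝ) < n := by exact_mod_cast hn
    have hfl : ⌊s * n⌋₊ ≤ ⌊t * n⌋₊ := Nat.floor_mono (mul_le_mul_of_nonneg_right h2 hn'.le)
    have hT' : fl n t - fl n s ≤ T := by
      have := fl_le n hn t (h1.trans h2)
      have := le_fl n hn s h1
      linarith
    refine ⟨by positivity, div_le_div_of_nonneg_right (by exact_mod_cast hfl) hn'.le, hT',
      hA.eulerScheme_expansion hγ hTs x₀ hn hfl ?_ hT'⟩
    have : t * n ≤ (n : ℝ) := by nlinarith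
    exact (Nat.floor_mono this).trans (Nat.floor_natCast n).le
  have hbdd : ∀ n : ℕ, 0 < n → 1 / (n : ℝ) ≤ T / 2 → ∀ t, 0 ≤ t → t ≤ 1 →
      ‖φ n t - x₀‖ ≤ ⌈1 / (T / 2)⌉₊ * (B + C) := by
    intro n hn h5 t ht ht1
    have h0 : φ n 0 = x₀ := by simp [φ, eulerScheme]
    rw [← h0]
    refine norm_sub_le_of_local (half_pos hT) (by positivity) ?_ 0 t le_rfl ht ht1
    intro s t h1 h2 h3 h4
    obtain ⟨e0, e1, e2, e3⟩ := step n hn s t h1 h2 h3 h4 h5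
    have e4 := hA.bound (fl n s) (fl n t) (φ n s) e0 e1
      ((fl_le n hn t (h1.trans h2)).trans h3)
    have e5 := norm_add_le (φ n t - φ n s - A (fl n s) (fl n t) (φ n s))
      (A (fl n s) (fl n t) (φ n s))
    rw [sub_add_cancel] at e5
    have hL : 0 ≤ fl n t - fl n s := by linarith
    have e6 : B * (fl n t - fl n s) ^ (2 * γ) ≤ B :=
      mul_le_of_le_one_right hB (Real.rpow_le_one hL (by linarith) (by linarith))
    have e7 : C * (fl n t - fl n s) ^ γ ≤ C :=
      mul_le_of_le_one_right hC.le (Real.rpow_le_one hL (by linarith) hγ0.le)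
    linarith
  let U : Ultrafilter ℕ := hyperfilter ℕ
  have hU : (U : Filter ℕ) ≤ atTop := Nat.hyperfilter_le_atTop
  have hlarge : ∀ᶠ n : ℕ in atTop, 0 < n ∧ 1 / (n : ℝ) ≤ T / 2 :=
    (eventually_gt_atTop 0).and
      (tendsto_one_div_atTop_nhds_zero_nat.eventually (ge_mem_nhds (half_pos hT)))
  have hlim : ∀ t, ∃ y, 0 ≤ t → t ≤ 1 → Tendsto (fun n => φ n t) U (𝓝 y) := by
    intro t
    by_cases ht : 0 ≤ t ∧ t ≤ 1
    · have hmem : ∀ᶠ n in (U : Filter ℕ),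
          φ n t ∈ Metric.closedBall x₀ (⌈1 / (T / 2)⌉₊ * (B + C)) := by
        filter_upwards [hU hlarge] with n hn
        rw [Metric.mem_closedBall, dist_eq_norm]
        exact hbdd n hn.1 hn.2 t ht.1 ht.2
      obtain ⟨y, -, hy⟩ := (isCompact_closedBall x₀ _).ultrafilter_le_nhds'
        (U.map fun n => φ n t) hmem
      exact ⟨y, fun _ _ => hy⟩
    · exact ⟨x₀, fun h1 h2 => absurd ⟨h1, h2⟩ ht⟩
  choose θ hθ using hlim
  have hexp : ∀ s t, 0 ≤ s → s ≤ t → t ≤ 1 → t - s ≤ T / 2 →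
      ‖θ t - θ s - A s t (θ s)‖ ≤ B * (t - s) ^ (2 * γ) := by
    intro s t h1 h2 h3 h4
    rcases h2.eq_or_lt with rfl | hlt
    · simp [hA.self_eq_zero hγ0 h1 h3, Real.zero_rpow (mul_pos two_pos hγ0).ne']
    have ls := hθ s h1 (h2.trans h3)
    have lt := hθ t (h1.trans h2) h3
    have fs := (fl_lim s h1).mono_left hU
    have ft := (fl_lim t (h1.trans h2)).mono_left hU
    have hpow : ∀ {f : ℕ → ℝ} {x β : ℝ}, 0 < β → Tendsto f U (𝓝 x) →
        Tendsto (fun n => f n ^ β) U (𝓝 (x ^ β)) := fun hβ h =>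
      h.rpow_const (Or.inr hβ.le)
    have lhs : Tendsto (fun n => ‖φ n t - φ n s - A s t (θ s)‖) U
        (𝓝 ‖θ t - θ s - A s t (θ s)‖) := ((lt.sub ls).sub_const _).norm
    have rhs : Tendsto (fun n => B * (fl n t - fl n s) ^ (2 * γ) + C * (s - fl n s) ^ γ
        + C * (t - fl n t) ^ γ + C * ‖φ n s - θ s‖) U (𝓝 (B * (t - s) ^ (2 * γ))) := by
      have := ((((hpow (β := 2 * γ) (by linarith) (ft.sub fs)).const_mul B).add
        ((hpow hγ0 (fs.const_sub s)).const_mul C)).add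
        ((hpow hγ0 (ft.const_sub t)).const_mul C)).add ((ls.sub_const (θ s)).norm.const_mul C)
      simpa [Real.zero_rpow hγ0.ne'] using this
    refine le_of_tendsto_of_tendsto lhs rhs ?_
    filter_upwards [hU hlarge, ft.eventually (lt_mem_nhds hlt)] with n hn hst
    obtain ⟨e0, e1, e2, e3⟩ := step n hn.1 s t h1 h2 h3 h4 hn.2
    have fls := fl_le n hn.1 s h1
    have flt := fl_le n hn.1 t (h1.trans h2)
    have d1 := hA.bound (fl n s) s (φ n s) e0 fls (h2.trans h3)
    have d2 := hA.bound (fl n t) t (φ n s) (e0.trans e1) flt h3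
    have d3 : ‖A s t (φ n s) - A s t (θ s)‖ ≤ C * ‖φ n s - θ s‖ :=
      (hA.lip s t (φ n s) (θ s) h1 h2 h3).trans (mul_le_mul_of_nonneg_right
        (mul_le_of_le_one_right hC.le (Real.rpow_le_one (by linarith) (by linarith) hγ0.le))
        (norm_nonneg _))
    have a1 := hA.add (fl n s) s (fl n t) (φ n s) e0 fls hst.le (flt.trans h3)
    have a2 := hA.add s (fl n t) t (φ n s) h1 hst.le flt h3
    have : φ n t - φ n s - A s t (θ s) = (φ n t - φ n s - A (fl n s) (fl n t) (φ n s))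
        + A (fl n s) s (φ n s) - A (fl n t) t (φ n s) + (A s t (φ n s) - A s t (θ s)) := by
      rw [a1, a2]; abel
    rw [this]
    exact norm_add_le_of_le (norm_sub_le_of_le (norm_add_le_of_le e3 d1) d2) d3
  refine ⟨θ, ?_, ?_, B, T / 2, hB, half_pos hT, hexp⟩
  · refine tendsto_nhds_unique (hθ 0 le_rfl zero_le_one) ?_
    have : (fun n => φ n 0) = fun _ => x₀ := by
      funext n; simp [φ, eulerScheme]
    rw [this]
    exact tendsto_const_nhds
  · refine holder_of_local hγ0.le (half_pos hT) (K := B + C) (by positivity) ?_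
    intro s t h1 h2 h3 h4
    have hL : 0 ≤ t - s := by linarith
    have e1 := norm_add_le (θ t - θ s - A s t (θ s)) (A s t (θ s))
    rw [sub_add_cancel] at e1
    have e2 := hexp s t h1 h2 h3 h4
    have e3 := hA.bound s t (θ s) h1 h2 h3
    have e4 : (t - s) ^ (2 * γ) ≤ (t - s) ^ γ :=
      Real.rpow_le_rpow_of_exponent_ge_of_imp hL (by linarith) (by linarith)
        (fun _ h => absurd h (mul_pos two_pos hγ0).ne')
    have e5 := mul_le_mul_of_nonneg_left e4 hB
    rw [add_mul]
    linarith

/-- Well-posedness of Young equations driven by a field with Lipschitz derivative. -/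
theorem IsYoungField.existsUnique_solution [ProperSpace E] (hA : IsYoungField A C γ)
    (hγ : 1 / 2 < γ) (x₀ : E) :
    (∃ θ : ℝ → E, HolderOnIcc γ θ ∧
      (θ 0 = x₀ ∧ ∀ t ∈ Set.Icc (0 : ℝ) 1, HasFieldIntegral A θ 0 t (θ t - x₀))) ∧
    ∀ θ ψ : ℝ → E, HolderOnIcc γ θ →
      (θ 0 = x₀ ∧ ∀ t ∈ Set.Icc (0 : ℝ) 1, HasFieldIntegral A θ 0 t (θ t - x₀)) →
      HolderOnIcc γ ψ →
      (ψ 0 = x₀ ∧ ∀ t ∈ Set.Icc (0 : ℝ) 1, HasFieldIntegral A ψ 0 t (ψ t - x₀)) →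
      ∀ t ∈ Set.Icc (0 : ℝ) 1, θ t = ψ t := by
  constructor
  · obtain ⟨θ, h0, hH, B, T, hB, hT, hexp⟩ := hA.exists_expansion hγ x₀
    refine ⟨θ, hH, h0, fun t ht => ?_⟩
    rw [← h0]
    exact hasFieldIntegral_of_expansion (by linarith) hB hT hexp ht.2
  · rintro θ ψ ⟨H₁, hH₁⟩ ⟨hθ0, hθ⟩ ⟨H₂, hH₂⟩ ⟨hψ0, hψ⟩ t ht
    set H := max 0 (max H₁ H₂)
    have hH : 0 ≤ H := le_max_left _ _
    have hol : ∀ (f : ℝ → E) (K : ℝ), K ≤ H →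
        (∀ s ∈ Set.Icc (0 : ℝ) 1, ∀ t ∈ Set.Icc (0 : ℝ) 1, ‖f t - f s‖ ≤ K * |t - s| ^ γ) →
        ∀ s t, 0 ≤ s → s ≤ t → t ≤ 1 → ‖f t - f s‖ ≤ H * (t - s) ^ γ := by
      intro f K hK hf s t h1 h2 h3
      have hL : 0 ≤ t - s := by linarith
      have := hf s ⟨h1, h2.trans h3⟩ t ⟨h1.trans h2, h3⟩
      rw [abs_of_nonneg hL] at this
      exact this.trans (mul_le_mul_of_nonneg_right hK (by positivity))
    have holθ := hol θ H₁ ((le_max_left _ _).trans (le_max_right _ _)) hH₁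
    have holψ := hol ψ H₂ ((le_max_right _ _).trans (le_max_right _ _)) hH₂
    exact hA.eq_of_expansion hγ hH holθ holψ
      (fun s t h1 h2 h3 => hA.expansion_of_integral hγ hH holθ hθ h1 h2 h3)
      (fun s t h1 h2 h3 => hA.expansion_of_integral hγ hH holψ hψ h1 h2 h3)
      (hθ0.trans hψ0.symm) t ht.1 ht.2

end YoungEquation

/-! ### Measurability of the Fourier transform -/

/-- The oscillatory integral `z ↦ ∫_s^t exp(i z c(u)) du` of a continuous phase is entire. -/
theorem hasDerivAt_oscillatory {c : ℝ → ℝ} (hc : Continuous c) (s t : ℝ) (z : ℂ) :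
    HasDerivAt (fun z : ℂ => ∫ u in s..t, Complex.exp (Complex.I * (z * c u)))
      (∫ u in s..t, Complex.I * c u * Complex.exp (Complex.I * (z * c u))) z := by
  have hcont : ∀ z : ℂ, Continuous fun u => Complex.exp (Complex.I * (z * c u)) :=
    fun z => by fun_prop
  have hcont' : Continuous fun u => Complex.I * c u * Complex.exp (Complex.I * (z * c u)) := by
    fun_prop
  refine (intervalIntegral.hasDerivAt_integral_of_dominated_loc_of_deriv_le
    (F' := fun z u => Complex.I * c u * Complex.exp (Complex.I * (z * c u)))
    (bound := fun u => |c u| * Real.exp ((‖z‖ + 1) * |c u|))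
    (Metric.ball_mem_nhds z one_pos)
    (Eventually.of_forall fun z => (hcont z).aestronglyMeasurable)
    ((hcont z).intervalIntegrable _ _) hcont'.aestronglyMeasurable ?_
    (Continuous.intervalIntegrable (by fun_prop) _ _) ?_).2
  · refine Eventually.of_forall fun u _ y hy => ?_
    rw [norm_mul, norm_mul, Complex.norm_I, one_mul, Complex.norm_real, Real.norm_eq_abs]
    refine mul_le_mul_of_nonneg_left ((Complex.norm_exp_le_exp_norm _).trans ?_) (abs_nonneg _)
    rw [Real.exp_le_exp, norm_mul, norm_mul, Complex.norm_I, one_mul, Complex.norm_real,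
      Real.norm_eq_abs]
    refine mul_le_mul_of_nonneg_right ?_ (abs_nonneg _)
    have h1 : ‖y - z‖ < 1 := by rw [← dist_eq_norm]; exact hy
    have := norm_add_le (y - z) z
    rw [sub_add_cancel] at this
    linarith
  · refine Eventually.of_forall fun u _ y _ => ?_
    have h1 : HasDerivAt (fun z : ℂ => Complex.I * (z * c u)) (Complex.I * (1 * c u)) y :=
      ((hasDerivAt_id y).mul_const _).const_mul _
    exact h1.cexp.congr_deriv (by ring)

theorem conj_oscillatory (c : ℝ → ℝ) (s t r : ℝ) :
    (starRingEnd ℂ) (∫ u in s..t, Complex.exp (Complex.I * (r * c u))) =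
      ∫ u in s..t, Complex.exp (Complex.I * (-r * c u)) := by
  rw [← intervalIntegral.intervalIntegral_conj]
  refine intervalIntegral.integral_congr fun u _ => ?_
  simp only [← Complex.exp_conj, map_mul, Complex.conj_I, Complex.conj_ofReal]
  congr 1
  ring

/-- Two oscillatory integrals with different mean phases are almost never collinear. -/
theorem ae_im_oscillatory_ne_zero {c₁ c₂ : ℝ → ℝ} (hc₁ : Continuous c₁) (hc₂ : Continuous c₂)
    {s₁ t₁ s₂ t₂ : ℝ}
    (h : (t₂ - s₂) * (∫ u in s₁..t₁, c₁ u) - (t₁ - s₁) * (∫ u in s₂..t₂, c₂ u) ≠ 0) :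
    ∀ᵐ r : ℝ, ((∫ u in s₁..t₁, Complex.exp (Complex.I * (r * c₁ u))) *
      (starRingEnd ℂ) (∫ u in s₂..t₂, Complex.exp (Complex.I * (r * c₂ u)))).im ≠ 0 := by
  set F₁ : ℂ → ℂ := fun z => ∫ u in s₁..t₁, Complex.exp (Complex.I * (z * c₁ u)) with hF₁
  set F₂ : ℂ → ℂ := fun z => ∫ u in s₂..t₂, Complex.exp (Complex.I * (z * c₂ u)) with hF₂
  have d₁ := hasDerivAt_oscillatory hc₁ s₁ t₁
  have d₂ := hasDerivAt_oscillatory hc₂ s₂ t₂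
  set D : ℂ → ℂ := fun z => F₁ z * F₂ (-z) - F₁ (-z) * F₂ z with hD
  have diff₁ : Differentiable ℂ F₁ := fun z => (d₁ z).differentiableAt
  have diff₂ : Differentiable ℂ F₂ := fun z => (d₂ z).differentiableAt
  have hDd : Differentiable ℂ D :=
    (diff₁.mul (diff₂.comp differentiable_neg)).sub ((diff₁.comp differentiable_neg).mul diff₂)
  have hD0 : HasDerivAt D (2 * Complex.I * ((t₂ - s₂) * ((∫ u in s₁..t₁, c₁ u : ℝ) : ℂ) -
      (t₁ - s₁) * ((∫ u in s₂..t₂, c₂ u : ℝ) : ℂ))) 0 := by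
    have e₁ : HasDerivAt F₁ (Complex.I * ((∫ u in s₁..t₁, c₁ u : ℝ) : ℂ)) 0 := by
      simpa [intervalIntegral.integral_const_mul, intervalIntegral.integral_ofReal] using d₁ 0
    have e₂ : HasDerivAt F₂ (Complex.I * ((∫ u in s₂..t₂, c₂ u : ℝ) : ℂ)) 0 := by
      simpa [intervalIntegral.integral_const_mul, intervalIntegral.integral_ofReal] using d₂ 0
    have n₁ : HasDerivAt (fun z => F₁ (-z)) (-(Complex.I * ((∫ u in s₁..t₁, c₁ u : ℝ) : ℂ))) 0 := by
      have e : HasDerivAt F₁ (Complex.I * ((∫ u in s₁..t₁, c₁ u : ℝ) : ℂ)) (-0) := by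
        rwa [neg_zero]
      exact (e.comp (0 : ℂ) (hasDerivAt_neg (0 : ℂ))).congr_deriv (by ring)
    have n₂ : HasDerivAt (fun z => F₂ (-z)) (-(Complex.I * ((∫ u in s₂..t₂, c₂ u : ℝ) : ℂ))) 0 := by
      have e : HasDerivAt F₂ (Complex.I * ((∫ u in s₂..t₂, c₂ u : ℝ) : ℂ)) (-0) := by
        rwa [neg_zero]
      exact (e.comp (0 : ℂ) (hasDerivAt_neg (0 : ℂ))).congr_deriv (by ring)
    have v₁ : F₁ 0 = t₁ - s₁ := by simp [hF₁]
    have v₂ : F₂ 0 = t₂ - s₂ := by simp [hF₂]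
    refine ((e₁.mul n₂).sub (n₁.mul e₂)).congr_deriv ?_
    rw [neg_zero, v₁, v₂]
    ring
  have hne : 2 * Complex.I * ((t₂ - s₂) * ((∫ u in s₁..t₁, c₁ u : ℝ) : ℂ) -
      (t₁ - s₁) * ((∫ u in s₂..t₂, c₂ u : ℝ) : ℂ)) ≠ 0 :=
    mul_ne_zero (mul_ne_zero two_ne_zero Complex.I_ne_zero) (by exact_mod_cast h)
  have hanal : AnalyticOnNhd ℝ (fun r : ℝ => D r) Set.univ := by
    intro r _
    have h1 : AnalyticAt ℝ D (r : ℂ) :=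
      (Complex.analyticOnNhd_univ_iff_differentiable.2 hDd (r : ℂ) trivial).restrictScalars
    exact h1.comp_of_eq (Complex.ofRealCLM.analyticAt r) rfl
  obtain ⟨x, hx⟩ : ∃ x : ℝ, D x ≠ 0 := by
    by_contra! hall
    have h0 := HasDerivAt.comp_ofReal (z := 0) (by simpa using hD0)
    have : (fun r : ℝ => D r) = fun _ => 0 := funext hall
    rw [this] at h0
    exact hne (h0.unique (hasDerivAt_const _ _))
  have hae := ae_restrict_le_codiscreteWithin (μ := (volume : Measure ℝ)) MeasurableSet.univ
    (hanal.preimage_zero_mem_codiscrete hx)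
  rw [Measure.restrict_univ] at hae
  filter_upwards [hae] with r hr him
  refine hr ?_
  change F₁ r * F₂ (-r) - F₁ (-r) * F₂ r = 0
  have k₁ : (starRingEnd ℂ) (F₁ r) = F₁ (-r) := conj_oscillatory c₁ s₁ t₁ r
  have k₂ : (starRingEnd ℂ) (F₂ r) = F₂ (-r) := conj_oscillatory c₂ s₂ t₂ r
  have him' := Complex.conj_eq_iff_im.2 him
  rw [map_mul, Complex.conj_conj] at him'
  rw [← k₁, ← k₂, sub_eq_zero]
  exact him'.symm

/-- A closed set meeting almost every line through the origin in a null set is null. -/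
theorem ae_ne_zero_of_ae_ae_smul {V : Type*} [NormedAddCommGroup V] [NormedSpace ℝ V]
    [MeasurableSpace V] [BorelSpace V] [FiniteDimensional ℝ V] (μ : Measure V)
    [μ.IsAddHaarMeasure] {G : V → ℝ} (hG : Continuous G)
    (h : ∀ᵐ p ∂μ, ∀ᵐ r : ℝ, G (r • p) ≠ 0) : ∀ᵐ p ∂μ, G p ≠ 0 := by
  have hmeas : MeasurableSet {x : V × ℝ | G (x.2 • x.1) ≠ 0} :=
    (isOpen_ne_fun (hG.comp (continuous_snd.smul continuous_fst)) continuous_const).measurableSet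
  have h' := (Measure.ae_ae_comm hmeas).1 h
  have hne : ∀ᵐ r : ℝ, r ≠ 0 := by simp [ae_iff]
  obtain ⟨r, hr, hr0⟩ := (h'.and hne).exists
  rw [ae_iff] at hr ⊢
  have : {p : V | ¬G (r • p) ≠ 0} = (r • ·) ⁻¹' {p | ¬G p ≠ 0} := rfl
  rw [this, Measure.addHaar_preimage_smul μ hr0, mul_eq_zero] at hr
  refine hr.resolve_left ?_
  simp [hr0]

/-- A complex function is determined by two non-collinear real projections. -/
theorem aemeasurable_of_re_mul {X : Type*} [MeasurableSpace X] {μ : Measure X} {g Φ Ψ : X → ℂ}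
    (hΦ : Measurable Φ) (hΨ : Measurable Ψ)
    (h₁ : AEMeasurable (fun p => (g p * Φ p).re) μ) (h₂ : AEMeasurable (fun p => (g p * Ψ p).re) μ)
    (hne : ∀ᵐ p ∂μ, (Φ p * (starRingEnd ℂ) (Ψ p)).im ≠ 0) : AEMeasurable g μ := by
  have hm : AEMeasurable (fun p => (((g p * Φ p).re : ℂ) * (starRingEnd ℂ) (Ψ p) -
      ((g p * Ψ p).re : ℂ) * (starRingEnd ℂ) (Φ p)) /
      (Complex.I * ((Φ p * (starRingEnd ℂ) (Ψ p)).im : ℂ))) μ := by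
    have hcΦ : Measurable fun p => (starRingEnd ℂ) (Φ p) :=
      Complex.continuous_conj.measurable.comp hΦ
    have hcΨ : Measurable fun p => (starRingEnd ℂ) (Ψ p) :=
      Complex.continuous_conj.measurable.comp hΨ
    have k₁ := Complex.measurable_ofReal.comp_aemeasurable h₁
    have k₂ := Complex.measurable_ofReal.comp_aemeasurable h₂
    have k₃ := Complex.measurable_ofReal.comp (Complex.measurable_im.comp (hΦ.mul hcΨ))
    exact ((k₁.mul hcΨ.aemeasurable).sub (k₂.mul hcΦ.aemeasurable)).div
      (measurable_const.mul k₃).aemeasurable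
  refine hm.congr ?_
  filter_upwards [hne] with p hp
  rw [div_eq_iff (mul_ne_zero Complex.I_ne_zero (by exact_mod_cast hp))]
  apply Complex.ext <;> simp <;> ring

theorem continuous_Yint {d : ℕ} {w : ℝ → Euc d} (hw : Continuous w) (s t : ℝ) :
    Continuous fun p : ℝ × Euc d => Yint w s t p.1 p.2 := by
  unfold Yint
  refine intervalIntegral.continuous_parametric_intervalIntegral_of_continuous' ?_ _ _
  simp only [Function.uncurry_def]
  fun_prop

/-- If two real projections of the integrand of `sigmaAvg`, over intervals with different
midpoints, are measurable then so is the Fourier transform. -/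
theorem aemeasurable_of_sigma_integrand {d : ℕ} {w : ℝ → Euc d} (hw : Continuous w)
    {g : ℝ × Euc d → ℂ} {s t s' t' : ℝ} {x x' : Euc d} (hst : s < t) (hst' : s' < t')
    (hne : s + t ≠ s' + t')
    (h₁ : AEMeasurable (fun p : ℝ × Euc d => (g p * Yint w s t p.1 p.2 *
      Complex.exp (Complex.I * Complex.ofReal (inner ℝ p.2 x))).re) volume)
    (h₂ : AEMeasurable (fun p : ℝ × Euc d => (g p * Yint w s' t' p.1 p.2 *
      Complex.exp (Complex.I * Complex.ofReal (inner ℝ p.2 x'))).re) volume) :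
    AEMeasurable g volume := by
  have : (volume : Measure (ℝ × Euc d)).IsAddHaarMeasure := by
    rw [Measure.volume_eq_prod]; infer_instance
  let Φ : ℝ → ℝ → Euc d → ℝ × Euc d → ℂ := fun s t x p => Yint w s t p.1 p.2 *
      Complex.exp (Complex.I * Complex.ofReal (inner ℝ p.2 x))
  have hΦ : ∀ s t x, Continuous (Φ s t x) := fun s t x =>
    (continuous_Yint hw s t).mul (by fun_prop)
  let c : Euc d → ℝ × Euc d → ℝ → ℝ := fun x p u => inner ℝ p.2 (w u) + p.1 * u + inner ℝ p.2 x
  have hc : ∀ x p, Continuous (c x p) := fun x p => by fun_prop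
  have hray : ∀ s t x p (r : ℝ), Φ s t x (r • p) =
      ∫ u in s..t, Complex.exp (Complex.I * (r * c x p u)) := by
    intro s t x p r
    simp only [Φ, Yint, c]
    rw [← intervalIntegral.integral_mul_const]
    refine intervalIntegral.integral_congr fun u _ => ?_
    simp only [← Complex.exp_add, Prod.smul_fst, Prod.smul_snd, real_inner_smul_left, smul_eq_mul]
    congr 1
    push_cast
    ring
  have hint : ∀ s t x p, ∫ u in s..t, c x p u =
      inner ℝ p.2 ((∫ u in s..t, w u) + (t - s) • x) + p.1 * ((t ^ 2 - s ^ 2) / 2) := by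
    intro s t x p
    have i₁ : ∫ u in s..t, inner ℝ p.2 (w u) = inner ℝ p.2 (∫ u in s..t, w u) :=
      (innerSL ℝ p.2).intervalIntegral_comp_comm (hw.intervalIntegrable s t)
    simp only [c]
    rw [intervalIntegral.integral_add, intervalIntegral.integral_add, i₁,
      intervalIntegral.integral_const_mul, integral_id, intervalIntegral.integral_const,
      inner_add_right, inner_smul_right, smul_eq_mul]
    · ring
    all_goals exact Continuous.intervalIntegrable (by fun_prop) _ _
  let v : Euc d := (t' - s') • ((∫ u in s..t, w u) + (t - s) • x) -
    (t - s) • ((∫ u in s'..t', w u) + (t' - s') • x')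
  let a : ℝ := (t' - s') * ((t ^ 2 - s ^ 2) / 2) - (t - s) * ((t' ^ 2 - s' ^ 2) / 2)
  have ha : a ≠ 0 := by
    have : a = (t' - s') * (t - s) * ((s + t) - (s' + t')) / 2 := by simp only [a]; ring
    rw [this]
    exact div_ne_zero (mul_ne_zero (mul_ne_zero (sub_pos.2 hst').ne' (sub_pos.2 hst).ne')
      (sub_ne_zero.2 hne)) two_ne_zero
  let l : ℝ × Euc d →ₗ[ℝ] ℝ := a • LinearMap.fst ℝ ℝ (Euc d) +
    (innerSL ℝ v).toLinearMap ∘ₗ LinearMap.snd ℝ ℝ (Euc d)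
  have hl : ∀ p, l p = (t' - s') * (∫ u in s..t, c x p u) - (t - s) * (∫ u in s'..t', c x' p u) := by
    intro p
    have h1 : l p = a * p.1 + inner ℝ p.2 v := by
      simp [l, real_inner_comm]
    rw [h1, hint, hint]
    simp only [v, a, inner_sub_right, inner_smul_right]
    ring
  have hlae : ∀ᵐ p : ℝ × Euc d, l p ≠ 0 := by
    have hker : LinearMap.ker l ≠ ⊤ := by
      intro h
      have : l (1, 0) = 0 := LinearMap.mem_ker.1 (h ▸ Submodule.mem_top)
      exact ha (by simpa [l] using this)
    have := Measure.addHaar_submodule (volume : Measure (ℝ × Euc d)) _ hker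
    rw [ae_iff]
    convert this using 2
    ext p
    simp
  refine aemeasurable_of_re_mul (hΦ s t x).measurable (hΦ s' t' x').measurable
    (by simpa only [Φ, mul_assoc] using h₁) (by simpa only [Φ, mul_assoc] using h₂) ?_
  refine ae_ne_zero_of_ae_ae_smul volume
    (Complex.continuous_im.comp ((hΦ s t x).mul (Complex.continuous_conj.comp (hΦ s' t' x')))) ?_
  filter_upwards [hlae] with p hp
  rw [hl] at hp
  filter_upwards [ae_im_oscillatory_ne_zero (hc x p) (hc x' p) hp] with r hr
  simpa only [Function.comp, hray] using hr

/-! ### The averaged field as a Young field -/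

theorem norm_Yint_le {d : ℕ} {w : ℝ → Euc d} {α γ : ℝ} (hK : avgK w α γ < ⊤) {s t : ℝ}
    (hs : 0 ≤ s) (hst : s ≤ t) (ht : t ≤ 1) (ω : ℝ) (ξ : Euc d) :
    ‖Yint w s t ω ξ‖ ≤ (avgK w α γ).toReal *
      ((1 + ‖ξ‖) ^ α * (1 + Real.sqrt (Real.log (1 + |ω|))) * (t - s) ^ γ) := by
  rcases hst.eq_or_lt with rfl | hlt
  · simp only [Yint, intervalIntegral.integral_same, norm_zero, sub_self]
    positivity
  · have hpos : 0 < (1 + ‖ξ‖) ^ α * (1 + Real.sqrt (Real.log (1 + |ω|))) * (t - s) ^ γ := by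
      have := sub_pos.2 hlt
      positivity
    rw [← div_le_iff₀ hpos, ← ENNReal.ofReal_le_iff_le_toReal hK.ne]
    exact le_iSup_of_le s <| le_iSup_of_le t <| le_iSup_of_le hs <| le_iSup_of_le hlt <|
      le_iSup_of_le ht <| le_iSup_of_le ω <| le_iSup_of_le ξ le_rfl

/-- The weighted `L¹` estimate behind all the bounds on the averaged field. -/
theorem lintegral_enorm_sigma_integrand_le {d : ℕ} {w : ℝ → Euc d} {α γ : ℝ}
    (hK : avgK w α γ < ⊤) {bhat : ℝ × Euc d → Fin d → ℂ} {s t : ℝ}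
    (hs : 0 ≤ s) (hst : s ≤ t) (ht : t ≤ 1) (i : Fin d) {φ : ℝ × Euc d → ℂ} {c : ℝ} (hc : 0 ≤ c)
    (hφ : ∀ p, ‖φ p‖ ≤ c * (1 + ‖p.2‖) ^ 2) :
    ∫⁻ p : ℝ × Euc d, ‖(bhat p i * Yint w s t p.1 p.2 * φ p).re‖ₑ ≤
      ENNReal.ofReal (c * (avgK w α γ).toReal * (t - s) ^ γ) * FLnorm d (α + 2) bhat := by
  have hts := sub_nonneg.2 hst
  rw [FLnorm, ← lintegral_const_mul' _ _ ENNReal.ofReal_ne_top]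
  refine lintegral_mono fun p => ?_
  rw [← ENNReal.ofReal_mul (by positivity), ← ofReal_norm]
  refine ENNReal.ofReal_le_ofReal ?_
  have h1 : (1 + ‖p.2‖) ^ (α + 2) = (1 + ‖p.2‖) ^ α * (1 + ‖p.2‖) ^ 2 := by
    rw [Real.rpow_add (by positivity), Real.rpow_two]
  calc ‖(bhat p i * Yint w s t p.1 p.2 * φ p).re‖
      ≤ ‖bhat p i * Yint w s t p.1 p.2 * φ p‖ := Complex.abs_re_le_norm _
    _ = ‖bhat p i‖ * ‖Yint w s t p.1 p.2‖ * ‖φ p‖ := by rw [norm_mul, norm_mul]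
    _ ≤ ‖bhat p‖ * ((avgK w α γ).toReal *
        ((1 + ‖p.2‖) ^ α * (1 + Real.sqrt (Real.log (1 + |p.1|))) * (t - s) ^ γ)) *
        (c * (1 + ‖p.2‖) ^ 2) := by
      gcongr
      · exact norm_le_pi_norm _ i
      · exact norm_Yint_le hK hs hst ht _ _
      · exact hφ p
    _ = c * (avgK w α γ).toReal * (t - s) ^ γ * (‖bhat p‖ * (1 + ‖p.2‖) ^ (α + 2) *
        (1 + Real.sqrt (Real.log (1 + |p.1|)))) := by rw [h1]; ring

theorem abs_integral_sigma_integrand_le {d : ℕ} {w : ℝ → Euc d} {α γ : ℝ}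
    (hK : avgK w α γ < ⊤) {bhat : ℝ × Euc d → Fin d → ℂ} (hb : FLnorm d (α + 2) bhat < ⊤)
    {s t : ℝ} (hs : 0 ≤ s) (hst : s ≤ t) (ht : t ≤ 1) (i : Fin d) {φ : ℝ × Euc d → ℂ} {c : ℝ}
    (hc : 0 ≤ c) (hφ : ∀ p, ‖φ p‖ ≤ c * (1 + ‖p.2‖) ^ 2) :
    |∫ p : ℝ × Euc d, (bhat p i * Yint w s t p.1 p.2 * φ p).re| ≤
      (avgK w α γ).toReal * (FLnorm d (α + 2) bhat).toReal * (t - s) ^ γ * c := by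
  have hts := sub_nonneg.2 hst
  have h := (enorm_integral_le_lintegral_enorm _).trans
    (lintegral_enorm_sigma_integrand_le (bhat := bhat) hK hs hst ht i hc hφ)
  have h' := ENNReal.toReal_mono (ENNReal.mul_lt_top ENNReal.ofReal_lt_top hb).ne h
  rw [toReal_enorm, ENNReal.toReal_mul, ENNReal.toReal_ofReal (by positivity),
    Real.norm_eq_abs] at h'
  linarith

theorem integrable_sigma_integrand {d : ℕ} {w : ℝ → Euc d} (hw : Continuous w) {α γ : ℝ}
    (hK : avgK w α γ < ⊤) {bhat : ℝ × Euc d → Fin d → ℂ} (hb : FLnorm d (α + 2) bhat < ⊤)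
    {i : Fin d} (hm : AEMeasurable (fun p => bhat p i) volume)
    {s t : ℝ} (hs : 0 ≤ s) (hst : s ≤ t) (ht : t ≤ 1) (x : Euc d) :
    Integrable fun p : ℝ × Euc d => (bhat p i * Yint w s t p.1 p.2 *
      Complex.exp (Complex.I * Complex.ofReal (inner ℝ p.2 x))).re := by
  refine ⟨?_, ?_⟩
  · refine AEMeasurable.aestronglyMeasurable (Complex.measurable_re.comp_aemeasurable ?_)
    refine (hm.mul (continuous_Yint hw s t).measurable.aemeasurable).mul ?_
    exact Continuous.aemeasurable (by fun_prop)
  · refine (lintegral_enorm_sigma_integrand_le hK hs hst ht i zero_le_one fun p => ?_).trans_lt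
      (ENNReal.mul_lt_top ENNReal.ofReal_lt_top hb)
    rw [mul_comm Complex.I, Complex.norm_exp_ofReal_mul_I]
    nlinarith [norm_nonneg p.2]

theorem norm_exp_I_mul_sub_le (a b : ℝ) :
    ‖Complex.exp (Complex.I * a) - Complex.exp (Complex.I * b)‖ ≤ |a - b| := by
  have h : Complex.exp (Complex.I * a) - Complex.exp (Complex.I * b) =
      Complex.exp (b * Complex.I) * (Complex.exp (Complex.I * ((a - b : ℝ) : ℂ)) - 1) := by
    rw [mul_sub, ← Complex.exp_add, mul_one]
    push_cast
    congr 2 <;> ring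
  rw [h, norm_mul, Complex.norm_exp_ofReal_mul_I, one_mul]
  exact Real.norm_exp_I_mul_ofReal_sub_one_le

theorem norm_exp_I_mul_sub_sub_add_le (a b a' b' : ℝ) :
    ‖Complex.exp (Complex.I * a) - Complex.exp (Complex.I * b) - Complex.exp (Complex.I * a') +
      Complex.exp (Complex.I * b')‖ ≤ |a - b - a' + b'| + |b - b'| * |a' - b'| := by
  have h : Complex.exp (Complex.I * a) - Complex.exp (Complex.I * b) -
      Complex.exp (Complex.I * a') + Complex.exp (Complex.I * b') =
      Complex.exp (b * Complex.I) * (Complex.exp (Complex.I * ((a - b : ℝ) : ℂ)) -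
        Complex.exp (Complex.I * ((a' - b' : ℝ) : ℂ))) +
      (Complex.exp (Complex.I * b) - Complex.exp (Complex.I * b')) *
        (Complex.exp (Complex.I * ((a' - b' : ℝ) : ℂ)) - 1) := by
    simp only [mul_sub, sub_mul, ← Complex.exp_add, mul_one]
    push_cast
    ring_nf
  rw [h]
  refine (norm_add_le _ _).trans ?_
  rw [norm_mul, norm_mul, Complex.norm_exp_ofReal_mul_I, one_mul]
  refine add_le_add ((norm_exp_I_mul_sub_le _ _).trans_eq (by ring_nf)) ?_
  exact mul_le_mul (norm_exp_I_mul_sub_le _ _) Real.norm_exp_I_mul_ofReal_sub_one_le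
    (norm_nonneg _) (abs_nonneg _)

theorem Euc.norm_le_card_mul {d : ℕ} {v : Euc d} {M : ℝ} (h : ∀ i, |v i| ≤ M) :
    ‖v‖ ≤ d * M := by
  have hv : v = ∑ i, EuclideanSpace.single i (v i) := by
    ext j
    simp [Finset.sum_apply]
  rw [hv]
  refine (norm_sum_le _ _).trans ((Finset.sum_le_sum (g := fun _ => M) fun i _ => ?_).trans_eq ?_)
  · simpa using h i
  · simp

theorem sigmaAvg_apply {d : ℕ} (w : ℝ → Euc d) (bhat : ℝ × Euc d → Fin d → ℂ) (s t : ℝ)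
    (x : Euc d) (i : Fin d) : sigmaAvg w bhat s t x i =
      ∫ p : ℝ × Euc d, (bhat p i * Yint w s t p.1 p.2 *
        Complex.exp (Complex.I * Complex.ofReal (inner ℝ p.2 x))).re := rfl

theorem abs_inner_sub_le {d : ℕ} (ξ x y : Euc d) :
    |inner ℝ ξ x - inner ℝ ξ y| ≤ ‖ξ‖ * ‖x - y‖ := by
  rw [← inner_sub_right]
  exact abs_real_inner_le_norm _ _

/-- The averaged field of a measurable Fourier transform satisfies the Young field estimates. -/
theorem isYoungField_sigmaAvg {d : ℕ} {w : ℝ → Euc d} (hw : Continuous w) {α γ : ℝ}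
    (hK : avgK w α γ < ⊤) {bhat : ℝ × Euc d → Fin d → ℂ} (hb : FLnorm d (α + 2) bhat < ⊤)
    (hm : ∀ i, AEMeasurable (fun p => bhat p i) volume) :
    IsYoungField (sigmaAvg w bhat)
      (d * ((avgK w α γ).toReal * (FLnorm d (α + 2) bhat).toReal) + 1) γ := by
  set Q := (avgK w α γ).toReal * (FLnorm d (α + 2) bhat).toReal with hQ
  have hQ0 : 0 ≤ Q := by positivity
  have hint := fun i s t x hs hst ht =>
    integrable_sigma_integrand hw hK hb (hm i) (s := s) (t := t) hs hst ht x
  have key : ∀ (v : Euc d) (s t c : ℝ), s ≤ t → 0 ≤ c → (∀ i, |v i| ≤ Q * (t - s) ^ γ * c) →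
      ‖v‖ ≤ (d * Q + 1) * (t - s) ^ γ * c := by
    intro v s t c hst hc hv
    have hts := sub_nonneg.2 hst
    have h1 := Euc.norm_le_card_mul hv
    have h2 : 0 ≤ (t - s) ^ γ * c := by positivity
    linarith
  refine ⟨by positivity, ?_, ?_, ?_, ?_⟩
  · intro s u t x hs hsu hut ht
    ext i
    rw [PiLp.add_apply, sigmaAvg_apply, sigmaAvg_apply, sigmaAvg_apply,
      ← integral_add (hint i s u x hs hsu (hut.trans ht)) (hint i u t x (hs.trans hsu) hut ht)]
    congr 1
    ext p
    have : Yint w s t p.1 p.2 = Yint w s u p.1 p.2 + Yint w u t p.1 p.2 :=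
      (intervalIntegral.integral_add_adjacent_intervals
        (Continuous.intervalIntegrable (by fun_prop) _ _)
        (Continuous.intervalIntegrable (by fun_prop) _ _)).symm
    rw [this, mul_add, add_mul, Complex.add_re]
  · intro s t x hs hst ht
    refine (key _ s t 1 hst zero_le_one fun i => ?_).trans_eq (mul_one _)
    refine abs_integral_sigma_integrand_le hK hb hs hst ht i zero_le_one fun p => ?_
    rw [mul_comm Complex.I, Complex.norm_exp_ofReal_mul_I]
    nlinarith [norm_nonneg p.2]
  · intro s t x y hs hst ht
    refine key _ s t _ hst (norm_nonneg _) fun i => ?_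
    rw [PiLp.sub_apply, sigmaAvg_apply, sigmaAvg_apply,
      ← integral_sub (hint i s t x hs hst ht) (hint i s t y hs hst ht)]
    simp only [← Complex.sub_re, ← mul_sub]
    refine abs_integral_sigma_integrand_le hK hb hs hst ht i (norm_nonneg _) fun p => ?_
    refine (norm_exp_I_mul_sub_le _ _).trans ((abs_inner_sub_le _ _ _).trans ?_)
    rw [mul_comm]
    gcongr
    nlinarith [norm_nonneg p.2]
  · intro s t x y x' y' hs hst ht
    refine key _ s t _ hst (by positivity) fun i => ?_
    rw [PiLp.add_apply, PiLp.sub_apply, PiLp.sub_apply, sigmaAvg_apply, sigmaAvg_apply,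
      sigmaAvg_apply, sigmaAvg_apply,
      ← integral_sub (hint i s t x hs hst ht) (hint i s t y hs hst ht),
      ← integral_sub ((hint i s t x hs hst ht).sub' (hint i s t y hs hst ht))
        (hint i s t x' hs hst ht),
      ← integral_add (((hint i s t x hs hst ht).sub' (hint i s t y hs hst ht)).sub'
        (hint i s t x' hs hst ht)) (hint i s t y' hs hst ht)]
    simp only [← Complex.sub_re, ← Complex.add_re, ← mul_sub, ← mul_add]
    refine abs_integral_sigma_integrand_le hK hb hs hst ht i (by positivity) fun p => ?_
    refine (norm_exp_I_mul_sub_sub_add_le _ _ _ _).trans ?_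
    have h1 : |inner ℝ p.2 x - inner ℝ p.2 y - inner ℝ p.2 x' + inner ℝ p.2 y'| ≤
        ‖p.2‖ * ‖x - y - x' + y'‖ := by
      rw [← inner_sub_right, ← inner_sub_right, ← inner_add_right]
      exact abs_real_inner_le_norm _ _
    have h2 := mul_le_mul (abs_inner_sub_le p.2 y y') (abs_inner_sub_le p.2 x' y')
      (abs_nonneg _) (by positivity)
    have h3 : ‖p.2‖ * ‖x - y - x' + y'‖ ≤ (1 + ‖p.2‖) ^ 2 * ‖x - y - x' + y'‖ := by
      gcongr
      nlinarith [norm_nonneg p.2]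
    have h4 : ‖p.2‖ ^ 2 * (‖y - y'‖ * ‖x' - y'‖) ≤ (1 + ‖p.2‖) ^ 2 * (‖y - y'‖ * ‖x' - y'‖) := by
      gcongr
      linarith
    linarith

/-! ### Reduction to continuous paths and measurable Fourier transforms -/

theorem Yint_congr {d : ℕ} {w w' : ℝ → Euc d} (h : Set.EqOn w w' (Set.Icc 0 1)) {s t : ℝ}
    (hs : s ∈ Set.Icc (0 : ℝ) 1) (ht : t ∈ Set.Icc (0 : ℝ) 1) (ω : ℝ) (ξ : Euc d) :
    Yint w s t ω ξ = Yint w' s t ω ξ :=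
  intervalIntegral.integral_congr fun u hu => by
    simp only [h (Set.uIcc_subset_Icc hs ht hu)]

theorem avgK_congr {d : ℕ} {w w' : ℝ → Euc d} (h : Set.EqOn w w' (Set.Icc 0 1)) (α γ : ℝ) :
    avgK w α γ = avgK w' α γ := by
  unfold avgK
  refine iSup_congr fun s => iSup_congr fun t => iSup_congr fun hs => iSup_congr fun hst =>
    iSup_congr fun ht => iSup_congr fun ω => iSup_congr fun ξ => ?_
  rw [Yint_congr h ⟨hs, hst.le.trans ht⟩ ⟨hs.trans hst.le, ht⟩]

theorem sigmaAvg_congr {d : ℕ} {w w' : ℝ → Euc d} (h : Set.EqOn w w' (Set.Icc 0 1))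
    (bhat : ℝ × Euc d → Fin d → ℂ) {s t : ℝ} (hs : s ∈ Set.Icc (0 : ℝ) 1)
    (ht : t ∈ Set.Icc (0 : ℝ) 1) (x : Euc d) : sigmaAvg w bhat s t x = sigmaAvg w' bhat s t x := by
  simp only [sigmaAvg, Yint_congr h hs ht]

open Classical in
/-- Replace the non-measurable components of a Fourier transform by zero. -/
def measurablePart {d : ℕ} (bhat : ℝ × Euc d → Fin d → ℂ) (p : ℝ × Euc d) (i : Fin d) : ℂ :=
  if AEMeasurable (fun q => bhat q i) volume then bhat p i else 0

theorem aemeasurable_measurablePart {d : ℕ} (bhat : ℝ × Euc d → Fin d → ℂ) (i : Fin d) :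
    AEMeasurable (fun p => measurablePart bhat p i) volume := by
  unfold measurablePart
  split_ifs with h
  · exact h
  · exact aemeasurable_const

theorem FLnorm_measurablePart_le {d : ℕ} (α : ℝ) (bhat : ℝ × Euc d → Fin d → ℂ) :
    FLnorm d α (measurablePart bhat) ≤ FLnorm d α bhat := by
  refine lintegral_mono fun p => ENNReal.ofReal_le_ofReal ?_
  have : ‖measurablePart bhat p‖ ≤ ‖bhat p‖ := by
    refine (pi_norm_le_iff_of_nonneg (norm_nonneg _)).2 fun i => ?_
    unfold measurablePart
    split_ifs
    · exact norm_le_pi_norm _ i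
    · simp
  gcongr

theorem sigmaAvg_measurablePart_apply_of_aemeasurable {d : ℕ} (w : ℝ → Euc d)
    {bhat : ℝ × Euc d → Fin d → ℂ} {i : Fin d} (h : AEMeasurable (fun q => bhat q i) volume)
    (s t : ℝ) (x : Euc d) : sigmaAvg w (measurablePart bhat) s t x i = sigmaAvg w bhat s t x i := by
  simp only [sigmaAvg_apply, measurablePart, if_pos h]

theorem sigmaAvg_measurablePart_apply_of_not_aemeasurable {d : ℕ} (w : ℝ → Euc d)
    {bhat : ℝ × Euc d → Fin d → ℂ} {i : Fin d} (h : ¬AEMeasurable (fun q => bhat q i) volume)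
    (s t : ℝ) (x : Euc d) : sigmaAvg w (measurablePart bhat) s t x i = 0 := by
  simp [sigmaAvg_apply, measurablePart, if_neg h]

/-- Over nondegenerate intervals, a non-measurable component of the averaged field vanishes
except for a single value of the midpoint. -/
theorem exists_midpoint_of_not_aemeasurable {d : ℕ} {w : ℝ → Euc d} (hw : Continuous w)
    {bhat : ℝ × Euc d → Fin d → ℂ} {i : Fin d} (h : ¬AEMeasurable (fun q => bhat q i) volume) :
    ∃ m : ℝ, ∀ s t x, s ≤ t → sigmaAvg w bhat s t x i ≠ 0 → s < t ∧ s + t = m := by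
  have hlt : ∀ s t x, s ≤ t → sigmaAvg w bhat s t x i ≠ 0 → s < t := by
    intro s t x hst hne
    refine hst.lt_of_ne ?_
    rintro rfl
    exact hne (by simp [sigmaAvg_apply, Yint])
  by_cases hex : ∃ s t x, s ≤ t ∧ sigmaAvg w bhat s t x i ≠ 0
  · obtain ⟨s', t', x', hst', hne'⟩ := hex
    refine ⟨s' + t', fun s t x hst hne => ⟨hlt s t x hst hne, ?_⟩⟩
    by_contra hmid
    have hmeas : ∀ s t x, sigmaAvg w bhat s t x i ≠ 0 →
        AEMeasurable (fun p : ℝ × Euc d => (bhat p i * Yint w s t p.1 p.2 *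
          Complex.exp (Complex.I * Complex.ofReal (inner ℝ p.2 x))).re) volume := by
      intro s t x hne
      by_contra hm
      exact hne (integral_undef fun hint => hm hint.aestronglyMeasurable.aemeasurable)
    exact h (aemeasurable_of_sigma_integrand hw (hlt s t x hst hne) (hlt s' t' x' hst' hne') hmid
      (hmeas s t x hne) (hmeas s' t' x' hne'))
  · push Not at hex
    exact ⟨0, fun s t x hst hne => absurd (hex s t x hst) hne⟩

/-- A sum over a partition, all of whose nonzero terms sit on nondegenerate intervals with
a common midpoint, has at most one nonzero term. -/
theorem IntervalPartition.abs_sum_le {s t : ℝ} (P : IntervalPartition s t) {f : ℕ → ℝ} {m M : ℝ}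
    (hM : 0 ≤ M) (hf : ∀ j < P.n, f j ≠ 0 →
      P.pts j < P.pts (j + 1) ∧ P.pts j + P.pts (j + 1) = m)
    (hfM : ∀ j < P.n, |f j| ≤ M) : |∑ j ∈ Finset.range P.n, f j| ≤ M := by
  by_cases hex : ∃ j < P.n, f j ≠ 0
  · obtain ⟨j, hj, hfj⟩ := hex
    obtain ⟨a₁, a₂⟩ := hf j hj hfj
    rw [Finset.sum_eq_single_of_mem j (Finset.mem_range.2 hj)]
    · exact hfM j hj
    · intro k hk hkj
      by_contra hfk
      have hk := Finset.mem_range.1 hk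
      obtain ⟨b₁, b₂⟩ := hf k hk hfk
      rcases lt_or_gt_of_ne hkj with hlt | hlt
      · have := P.pts_le (Nat.succ_le_of_lt hlt) hj.le
        rw [Nat.succ_eq_add_one] at this
        linarith
      · have := P.pts_le (Nat.succ_le_of_lt hlt) hk.le
        rw [Nat.succ_eq_add_one] at this
        linarith
  · push Not at hex
    rw [Finset.sum_eq_zero fun j hj => hex j (Finset.mem_range.1 hj), abs_zero]
    exact hM

theorem norm_sum_sigmaAvg_sub_measurablePart_le {d : ℕ} {w : ℝ → Euc d} (hw : Continuous w)
    {α γ : ℝ} (hγ : 0 ≤ γ) (hK : avgK w α γ < ⊤) {bhat : ℝ × Euc d → Fin d → ℂ}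
    (hb : FLnorm d (α + 2) bhat < ⊤) (θ : ℝ → Euc d) {t δ : ℝ} (ht : t ≤ 1)
    (hδ : 0 ≤ δ) (P : IntervalPartition 0 t) (hP : P.MeshLt δ) :
    ‖∑ j ∈ Finset.range P.n, sigmaAvg w bhat (P.pts j) (P.pts (j + 1)) (θ (P.pts j)) -
      ∑ j ∈ Finset.range P.n,
        sigmaAvg w (measurablePart bhat) (P.pts j) (P.pts (j + 1)) (θ (P.pts j))‖ ≤
      d * ((avgK w α γ).toReal * (FLnorm d (α + 2) bhat).toReal * δ ^ γ) := by
  refine Euc.norm_le_card_mul fun i => ?_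
  rw [PiLp.sub_apply, WithLp.ofLp_sum, WithLp.ofLp_sum, Finset.sum_apply, Finset.sum_apply]
  by_cases h : AEMeasurable (fun q => bhat q i) volume
  · simp only [sigmaAvg_measurablePart_apply_of_aemeasurable w h, sub_self, abs_zero]
    positivity
  · simp only [sigmaAvg_measurablePart_apply_of_not_aemeasurable w h, Finset.sum_const_zero,
      sub_zero]
    obtain ⟨m, hm⟩ := exists_midpoint_of_not_aemeasurable hw h
    refine P.abs_sum_le (by positivity) (fun j hj hne => hm _ _ _ (P.mono j hj) hne) fun j hj => ?_
    have hj0 := (P.pts_mem_Icc hj.le).1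
    have hj1 := (P.pts_mem_Icc (Nat.succ_le_of_lt hj)).2.trans ht
    have hle := abs_integral_sigma_integrand_le hK hb hj0 (P.mono j hj) hj1 i zero_le_one
      (φ := fun p => Complex.exp (Complex.I * Complex.ofReal (inner ℝ p.2 (θ (P.pts j)))))
      fun p => by
        rw [mul_comm Complex.I, Complex.norm_exp_ofReal_mul_I]
        nlinarith [norm_nonneg p.2]
    rw [mul_one] at hle
    refine hle.trans ?_
    have := sub_nonneg.2 (P.mono j hj)
    gcongr
    exact (hP j hj).le

theorem HasFieldIntegral.of_sum_sub_tendsto_zero {E : Type*} [NormedAddCommGroup E]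
    {A B : ℝ → ℝ → E → E} {θ : ℝ → E} {s t : ℝ} {L : E}
    (h : ∀ ε > 0, ∃ δ > 0, ∀ P : IntervalPartition s t, P.MeshLt δ →
      ‖∑ j ∈ Finset.range P.n, A (P.pts j) (P.pts (j + 1)) (θ (P.pts j)) -
        ∑ j ∈ Finset.range P.n, B (P.pts j) (P.pts (j + 1)) (θ (P.pts j))‖ < ε)
    (hB : HasFieldIntegral B θ s t L) : HasFieldIntegral A θ s t L := by
  intro ε hε
  obtain ⟨δ₁, hδ₁, h₁⟩ := h (ε / 2) (half_pos hε)
  obtain ⟨δ₂, hδ₂, h₂⟩ := hB (ε / 2) (half_pos hε)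
  refine ⟨min δ₁ δ₂, lt_min hδ₁ hδ₂, fun P hP => ?_⟩
  have e₁ := h₁ P fun i hi => (hP i hi).trans_le (min_le_left _ _)
  have e₂ := h₂ P fun i hi => (hP i hi).trans_le (min_le_right _ _)
  refine (norm_sub_le_norm_sub_add_norm_sub _ _ _).trans_lt ((add_lt_add e₁ e₂).trans_eq ?_)
  ring

/-- The Young integral only sees the path on `[0,1]` and the measurable components. -/
theorem hasSigmaIntegral_iff_measurablePart {d : ℕ} {w w' : ℝ → Euc d}
    (heq : Set.EqOn w w' (Set.Icc 0 1)) (hw' : Continuous w')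
    {α γ : ℝ} (hγ : 0 < γ) (hK : avgK w' α γ < ⊤) {bhat : ℝ × Euc d → Fin d → ℂ}
    (hb : FLnorm d (α + 2) bhat < ⊤) (θ : ℝ → Euc d) {t : ℝ} (ht : t ≤ 1) (L : Euc d) :
    HasSigmaIntegral w bhat θ 0 t L ↔
      HasFieldIntegral (sigmaAvg w' (measurablePart bhat)) θ 0 t L := by
  have hclose : ∀ ε > 0, ∃ δ > 0, ∀ P : IntervalPartition 0 t, P.MeshLt δ →
      ‖∑ j ∈ Finset.range P.n, sigmaAvg w bhat (P.pts j) (P.pts (j + 1)) (θ (P.pts j)) -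
        ∑ j ∈ Finset.range P.n,
          sigmaAvg w' (measurablePart bhat) (P.pts j) (P.pts (j + 1)) (θ (P.pts j))‖ < ε := by
    intro ε hε
    obtain ⟨δ, hδ, _, hδε⟩ := exists_small_scale hγ (half_pos hε)
      (d * ((avgK w' α γ).toReal * (FLnorm d (α + 2) bhat).toReal))
    refine ⟨δ, hδ, fun P hP => ?_⟩
    have hmem : ∀ i ≤ P.n, P.pts i ∈ Set.Icc (0 : ℝ) 1 := fun i hi =>
      ⟨(P.pts_mem_Icc hi).1, (P.pts_mem_Icc hi).2.trans ht⟩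
    have hsum : ∑ j ∈ Finset.range P.n, sigmaAvg w bhat (P.pts j) (P.pts (j + 1)) (θ (P.pts j)) =
        ∑ j ∈ Finset.range P.n, sigmaAvg w' bhat (P.pts j) (P.pts (j + 1)) (θ (P.pts j)) := by
      refine Finset.sum_congr rfl fun j hj => ?_
      have hj := Finset.mem_range.1 hj
      exact sigmaAvg_congr heq bhat (hmem j hj.le) (hmem (j + 1) hj) _
    rw [hsum]
    have := norm_sum_sigmaAvg_sub_measurablePart_le hw' hγ.le hK hb θ ht hδ.le P hP
    linarith
  constructor
  · refine HasFieldIntegral.of_sum_sub_tendsto_zero fun ε hε => ?_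
    obtain ⟨δ, hδ, h⟩ := hclose ε hε
    exact ⟨δ, hδ, fun P hP => by rw [norm_sub_rev]; exact h P hP⟩
  · exact HasFieldIntegral.of_sum_sub_tendsto_zero hclose

/-- Existence and uniqueness of the `γ`-Hölder solution of the Young
equation `θ_t = x₀ + ∫_0^t (σ^w_{du} b)(θ_u)` on `[0,1]` for `b ∈ FL^{α+2}`, when
`K^w_{α,γ} < ∞` and `γ > 1/2`. -/
theorem statement9 (d : ℕ) (α γ : ℝ) (hγ : 1 / 2 < γ) (hγ1 : γ ≤ 1)
    (w : ℝ → Euc d) (hw : ContinuousOn w (Set.Icc 0 1)) (hK : avgK w α γ < ⊤)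
    (bhat : ℝ × Euc d → Fin d → ℂ) (hb : FLnorm d (α + 2) bhat < ⊤) (x₀ : Euc d) :
    (∃ θ : ℝ → Euc d, HolderOnIcc γ θ ∧ SolvesSigmaYoung w bhat x₀ θ) ∧
    ∀ θ ψ : ℝ → Euc d, HolderOnIcc γ θ → SolvesSigmaYoung w bhat x₀ θ →
      HolderOnIcc γ ψ → SolvesSigmaYoung w bhat x₀ ψ →
      ∀ t ∈ Set.Icc (0 : ℝ) 1, θ t = ψ t := by
  set w' : ℝ → Euc d := Set.IccExtend zero_le_one ((Set.Icc 0 1).domRestrict w) with hw'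
  have heq : Set.EqOn w w' (Set.Icc 0 1) := fun u hu => by
    rw [hw', Set.IccExtend_of_mem _ _ hu, Set.domRestrict_apply]
  have hcont : Continuous w' := (continuousOn_iff_continuous_domRestrict.1 hw).Icc_extend'
  rw [avgK_congr heq] at hK
  have hsol : ∀ θ : ℝ → Euc d, SolvesSigmaYoung w bhat x₀ θ ↔ (θ 0 = x₀ ∧
      ∀ t ∈ Set.Icc (0 : ℝ) 1,
        HasFieldIntegral (sigmaAvg w' (measurablePart bhat)) θ 0 t (θ t - x₀)) := fun θ =>
    and_congr_right fun _ => forall₂_congr fun t ht =>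
      hasSigmaIntegral_iff_measurablePart heq hcont (by linarith) hK hb θ ht.2 _
  simp only [hsol]
  exact (isYoungField_sigmaAvg hcont hK ((FLnorm_measurablePart_le _ _).trans_lt hb)
    (aemeasurable_measurablePart bhat)).existsUnique_solution hγ x₀
end
end

section
/- Let H > 0, d ≥ 1 and λ ∈ (0,1]. There is a constant C depending only on H, d and λ such that for every continuous path w : [0,1] → ℝ^d with R^w_λ < ∞ and S^w_λ < ∞, all 0 ≤ s < t ≤ 1 and all (ω,ξ) ∈ ℝ × ℝ^d: |Y^w_{s,t}(ω,ξ)| ≤ C (t−s)^{1/2} (1+|ξ|)^{−1/(2H)} (1 + Q^w_λ + |log(t−s)|^{1/2} + log^{1/2}(1+|ω|) + log^{1/2}(1+|ξ|)). -/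
open MeasureTheory Filter Topology
open scoped ENNReal NNReal

noncomputable section

/-- The geometric gain of one dyadic scale absorbs the growth of `√n`. -/
lemma dyadic_weight_telescope {A : ℝ} (hA : 4 ≤ A) (n : ℕ) :
    √(1 / 2) ^ (n + 1) * (A + √((n + 1 : ℕ) : ℝ)) +
      10 * (√(1 / 2) ^ (n + 1) * (A + √((n + 1 : ℕ) : ℝ))) ≤
      10 * (√(1 / 2) ^ n * (A + √(n : ℝ))) := by
  have hr0 : 0 ≤ √(1 / 2 : ℝ) := Real.sqrt_nonneg _
  have hr1 : √(1 / 2 : ℝ) ≤ 0.71 := by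
    rw [Real.sqrt_le_left (by norm_num)]; norm_num
  have hn : √((n + 1 : ℕ) : ℝ) ≤ √(n : ℝ) + 1 := by
    rw [Real.sqrt_le_left (by positivity)]
    push_cast
    nlinarith [Real.sq_sqrt (Nat.cast_nonneg (α := ℝ) n), Real.sqrt_nonneg (n : ℝ)]
  have hs : 0 ≤ √(n : ℝ) := Real.sqrt_nonneg _
  have key : 11 * (√(1 / 2 : ℝ) * (A + √((n + 1 : ℕ) : ℝ))) ≤ 10 * (A + √(n : ℝ)) := by
    have : √(1 / 2 : ℝ) * (A + √((n + 1 : ℕ) : ℝ)) ≤ 0.71 * (A + (√(n : ℝ) + 1)) := by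
      gcongr
    linarith
  have hp : 0 ≤ √(1 / 2 : ℝ) ^ n := by positivity
  have := mul_le_mul_of_nonneg_left key hp
  rw [pow_succ]
  linarith

/-- One-sided chaining: from a dyadic approximation of `t` from below up to `t` itself. -/
lemma norm_sub_dyadic_floor_le {F : ℝ → ℂ} {A K : ℝ} (hA : 4 ≤ A) (hK : 0 ≤ K)
    (hF : ∀ s t, 0 ≤ s → s ≤ t → t ≤ 1 → ‖F t - F s‖ ≤ t - s)
    (hdy : ∀ n k : ℕ, k < 2 ^ n →
      ‖F (((k : ℝ) + 1) / 2 ^ n) - F ((k : ℝ) / 2 ^ n)‖ ≤ K * (√(1 / 2) ^ n * (A + √(n : ℝ))))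
    {t : ℝ} (ht0 : 0 ≤ t) (ht1 : t ≤ 1) (n : ℕ) :
    ‖F t - F ((⌊t * 2 ^ n⌋₊ : ℝ) / 2 ^ n)‖ ≤ 10 * K * (√(1 / 2) ^ n * (A + √(n : ℝ))) := by
  set B : ℕ → ℝ := fun n => √(1 / 2) ^ n * (A + √(n : ℝ)) with hB
  have hB0 : ∀ n, 0 ≤ B n := fun n => by
    have := Real.sqrt_nonneg (n : ℝ)
    have : 0 ≤ A + √(n : ℝ) := by linarith
    simp only [hB]; positivity
  have hstep : ∀ n : ℕ, ‖F ((⌊t * 2 ^ (n + 1)⌋₊ : ℝ) / 2 ^ (n + 1)) -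
      F ((⌊t * 2 ^ n⌋₊ : ℝ) / 2 ^ n)‖ ≤ K * B (n + 1) := by
    intro n
    have hp : (0 : ℝ) < 2 ^ n := by positivity
    have h1 := Nat.floor_le (by positivity : 0 ≤ t * 2 ^ n)
    have h2 := Nat.lt_floor_add_one (t * 2 ^ n)
    have hle : ⌊t * 2 ^ (n + 1)⌋₊ ≤ 2 ^ (n + 1) := by
      apply Nat.floor_le_of_le
      push_cast
      nlinarith [pow_pos (two_pos : (0 : ℝ) < 2) (n + 1)]
    have hlo : 2 * ⌊t * 2 ^ n⌋₊ ≤ ⌊t * 2 ^ (n + 1)⌋₊ := by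
      apply Nat.le_floor
      push_cast
      rw [pow_succ]; linarith
    have hhi : ⌊t * 2 ^ (n + 1)⌋₊ < 2 * ⌊t * 2 ^ n⌋₊ + 2 := by
      rw [Nat.floor_lt (by positivity)]
      push_cast
      rw [pow_succ]; linarith
    have hbase : (⌊t * 2 ^ n⌋₊ : ℝ) / 2 ^ n =
        ((2 * ⌊t * 2 ^ n⌋₊ : ℕ) : ℝ) / 2 ^ (n + 1) := by
      push_cast
      rw [pow_succ]; field_simp
    rw [hbase]
    rcases (by omega : ⌊t * 2 ^ (n + 1)⌋₊ = 2 * ⌊t * 2 ^ n⌋₊ ∨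
      ⌊t * 2 ^ (n + 1)⌋₊ = 2 * ⌊t * 2 ^ n⌋₊ + 1) with h | h
    · rw [h, sub_self, norm_zero]
      exact mul_nonneg hK (hB0 _)
    · have := hdy (n + 1) (2 * ⌊t * 2 ^ n⌋₊) (by omega)
      rw [h]
      push_cast at this ⊢
      simpa [hB] using this
  have hchain : ∀ N n : ℕ, ‖F ((⌊t * 2 ^ (n + N)⌋₊ : ℝ) / 2 ^ (n + N)) -
      F ((⌊t * 2 ^ n⌋₊ : ℝ) / 2 ^ n)‖ ≤ 10 * K * B n - 10 * K * B (n + N) := by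
    intro N n
    induction N with
    | zero => simp
    | succ N ih =>
      have h1 := hstep (n + N)
      have h2 := mul_le_mul_of_nonneg_left (dyadic_weight_telescope hA (n + N)) hK
      have h3 := norm_sub_le_norm_sub_add_norm_sub
        (F ((⌊t * 2 ^ (n + N + 1)⌋₊ : ℝ) / 2 ^ (n + N + 1)))
        (F ((⌊t * 2 ^ (n + N)⌋₊ : ℝ) / 2 ^ (n + N))) (F ((⌊t * 2 ^ n⌋₊ : ℝ) / 2 ^ n))
      rw [← add_assoc]
      simp only [hB] at *
      linarith
  have hbound : ∀ N : ℕ, ‖F t - F ((⌊t * 2 ^ n⌋₊ : ℝ) / 2 ^ n)‖ ≤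
      10 * K * B n + (1 / 2) ^ N := by
    intro N
    have hp : (0 : ℝ) < 2 ^ (n + N) := by positivity
    have h1 := Nat.floor_le (by positivity : 0 ≤ t * 2 ^ (n + N))
    have h2 := Nat.lt_floor_add_one (t * 2 ^ (n + N))
    have h3 := hF ((⌊t * 2 ^ (n + N)⌋₊ : ℝ) / 2 ^ (n + N)) t (by positivity)
      (by rw [div_le_iff₀ hp]; exact h1) ht1
    have h4 : t - (⌊t * 2 ^ (n + N)⌋₊ : ℝ) / 2 ^ (n + N) ≤ (1 / 2) ^ N := by
      have : t - (⌊t * 2 ^ (n + N)⌋₊ : ℝ) / 2 ^ (n + N) ≤ 1 / 2 ^ (n + N) := by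
        rw [sub_le_iff_le_add, ← add_div, le_div_iff₀ hp]; linarith
      refine this.trans ?_
      rw [one_div_pow]
      exact one_div_le_one_div_of_le (by positivity)
        (pow_le_pow_right₀ (by norm_num) (by omega))
    have h5 := hchain N n
    have h6 := norm_sub_le_norm_sub_add_norm_sub (F t)
      (F ((⌊t * 2 ^ (n + N)⌋₊ : ℝ) / 2 ^ (n + N))) (F ((⌊t * 2 ^ n⌋₊ : ℝ) / 2 ^ n))
    have h7 : 0 ≤ 10 * K * B (n + N) := mul_nonneg (by positivity) (hB0 _)
    linarith
  have hlim : Tendsto (fun N : ℕ => 10 * K * B n + (1 / 2 : ℝ) ^ N) atTop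
      (𝓝 (10 * K * B n + 0)) :=
    tendsto_const_nhds.add (tendsto_pow_atTop_nhds_zero_of_lt_one (by norm_num) (by norm_num))
  have := ge_of_tendsto' hlim hbound
  rwa [add_zero] at this

/-- Chaining: control of the increments over dyadic intervals yields control of all increments. -/
lemma norm_sub_le_of_dyadic {F : ℝ → ℂ} {A K : ℝ} (hA : 4 ≤ A) (hK : 0 ≤ K)
    (hF : ∀ s t, 0 ≤ s → s ≤ t → t ≤ 1 → ‖F t - F s‖ ≤ t - s)
    (hdy : ∀ n k : ℕ, k < 2 ^ n →
      ‖F (((k : ℝ) + 1) / 2 ^ n) - F ((k : ℝ) / 2 ^ n)‖ ≤ K * (√(1 / 2) ^ n * (A + √(n : ℝ))))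
    {s t : ℝ} (hs0 : 0 ≤ s) (hst : s < t) (ht1 : t ≤ 1) :
    ‖F t - F s‖ ≤ 84 * K * √(t - s) * (A + √|Real.log (t - s)|) := by
  have hr0 : 0 ≤ √(1 / 2 : ℝ) := Real.sqrt_nonneg _
  obtain ⟨n, hn1, hn2⟩ := exists_nat_pow_near_of_lt_one (sub_pos.2 hst) (by linarith : t - s ≤ 1)
    (by norm_num : (0 : ℝ) < 1 / 2) (by norm_num)
  have hp : (0 : ℝ) < 2 ^ n := by positivity
  have hmid : ‖F ((⌊t * 2 ^ n⌋₊ : ℝ) / 2 ^ n) - F ((⌊s * 2 ^ n⌋₊ : ℝ) / 2 ^ n)‖ ≤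
      K * (√(1 / 2) ^ n * (A + √(n : ℝ))) := by
    have hts : t * 2 ^ n - s * 2 ^ n ≤ 1 := by
      rw [← sub_mul]
      calc (t - s) * 2 ^ n ≤ (1 / 2) ^ n * 2 ^ n := by gcongr
        _ = 1 := by rw [← mul_pow]; norm_num
    have h1 := Nat.lt_floor_add_one (s * 2 ^ n)
    have hle : ⌊t * 2 ^ n⌋₊ ≤ 2 ^ n := by
      apply Nat.floor_le_of_le
      push_cast
      nlinarith
    have hlo : ⌊s * 2 ^ n⌋₊ ≤ ⌊t * 2 ^ n⌋₊ := Nat.floor_mono (by gcongr)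
    have hhi : ⌊t * 2 ^ n⌋₊ < ⌊s * 2 ^ n⌋₊ + 2 := by
      rw [Nat.floor_lt (by nlinarith)]
      push_cast
      linarith
    rcases (by omega : ⌊t * 2 ^ n⌋₊ = ⌊s * 2 ^ n⌋₊ ∨ ⌊t * 2 ^ n⌋₊ = ⌊s * 2 ^ n⌋₊ + 1) with h | h
    · rw [h, sub_self, norm_zero]
      positivity
    · rw [h]
      push_cast
      exact hdy n _ (by omega)
  have ht := norm_sub_dyadic_floor_le hA hK hF hdy (by linarith) ht1 n
  have hs := norm_sub_dyadic_floor_le hA hK hF hdy hs0 (by linarith) n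
  have htri : ‖F t - F s‖ ≤ 21 * K * (√(1 / 2) ^ n * (A + √(n : ℝ))) := by
    have e1 := norm_sub_le_norm_sub_add_norm_sub (F t) (F ((⌊t * 2 ^ n⌋₊ : ℝ) / 2 ^ n)) (F s)
    have e2 := norm_sub_le_norm_sub_add_norm_sub (F ((⌊t * 2 ^ n⌋₊ : ℝ) / 2 ^ n))
      (F ((⌊s * 2 ^ n⌋₊ : ℝ) / 2 ^ n)) (F s)
    rw [norm_sub_rev (F ((⌊s * 2 ^ n⌋₊ : ℝ) / 2 ^ n)) (F s)] at e2
    linarith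
  have hrn : √(1 / 2 : ℝ) ^ n ≤ 2 * √(t - s) := by
    have : √(1 / 2 : ℝ) ^ n ≤ √(4 * (t - s)) := by
      apply Real.le_sqrt_of_sq_le
      rw [← pow_mul, mul_comm n 2, pow_mul, Real.sq_sqrt (by norm_num)]
      rw [pow_succ] at hn1
      nlinarith
    rwa [Real.sqrt_mul (by norm_num), (by norm_num : (4 : ℝ) = 2 ^ 2),
      Real.sqrt_sq (by norm_num)] at this
  have hsn : √(n : ℝ) ≤ 2 * √|Real.log (t - s)| := by
    have hl : (n : ℝ) * Real.log 2 ≤ |Real.log (t - s)| := by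
      have := Real.log_le_log (sub_pos.2 hst) hn2
      rw [Real.log_pow, one_div, Real.log_inv] at this
      have h' := neg_le_abs (Real.log (t - s))
      linarith
    have : √(n : ℝ) ≤ √(4 * |Real.log (t - s)|) := by
      apply Real.sqrt_le_sqrt
      nlinarith [Real.log_two_gt_d9, Nat.cast_nonneg (α := ℝ) n]
    rwa [Real.sqrt_mul (by norm_num), (by norm_num : (4 : ℝ) = 2 ^ 2),
      Real.sqrt_sq (by norm_num)] at this
  calc ‖F t - F s‖ ≤ 21 * K * (√(1 / 2) ^ n * (A + √(n : ℝ))) := htri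
    _ ≤ 21 * K * ((2 * √(t - s)) * (2 * (A + √|Real.log (t - s)|))) := by
      gcongr
      linarith
    _ = 84 * K * √(t - s) * (A + √|Real.log (t - s)|) := by ring

/-- A single term of the series defining `Sconst` controls `Yint` on a dyadic interval at a
grid frequency. -/
lemma Yint_grid_bound {d : ℕ} {H lam : ℝ} (hlam : 0 < lam) {w : ℝ → Euc d}
    (hS : Sconst H lam w < ⊤) (n m : ℕ) {k : ℕ} (hk : k < 2 ^ n) (a : ℤ) (b : Fin d → ℤ)
    {ω : ℝ} {ξ : Euc d} (hω : ω = (a : ℝ) / 2 ^ m)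
    (hξ : ξ = (EuclideanSpace.equiv (Fin d) ℝ).symm (fun i => (b i : ℝ) / 2 ^ m)) :
    lam * 2 ^ n * (1 + ‖ξ‖) ^ (1 / H) *
        ‖Yint w ((k : ℝ) / 2 ^ n) (((k : ℝ) + 1) / 2 ^ n) ω ξ‖ ^ 2 ≤
      lam * Real.log (Sconst H lam w).toReal + (2 * n + m * (d + 2)) * Real.log 2 +
        2 * Real.log (1 + |ω|) + (d + 1) * Real.log (1 + ‖ξ‖) := by
  set E : ℝ := lam * 2 ^ n * (1 + ‖ξ‖) ^ (1 / H) *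
    ‖Yint w ((k : ℝ) / 2 ^ n) (((k : ℝ) + 1) / 2 ^ n) ω ξ‖ ^ 2 with hE
  set W : ℝ := (2 : ℝ) ^ (-(2 * (n : ℝ)) - (m : ℝ) * ((d : ℝ) + 2)) *
    (1 + |ω|) ^ (-(2 : ℝ)) * (1 + ‖ξ‖) ^ (-((d : ℝ) + 1)) with hW
  have hω0 : 0 < 1 + |ω| := by positivity
  have hξ0 : 0 < 1 + ‖ξ‖ := by positivity
  have hterm : ENNReal.ofReal (W * Real.exp E) ≤ Sconst H lam w ^ lam := by
    rw [Sconst, ← ENNReal.rpow_mul, one_div_mul_cancel hlam.ne', ENNReal.rpow_one]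
    refine le_trans ?_ (ENNReal.le_tsum n)
    refine le_trans ?_ (ENNReal.le_tsum m)
    refine le_trans ?_ (Finset.single_le_sum (fun _ _ => zero_le) (Finset.mem_range.2 hk))
    refine le_trans ?_ (ENNReal.le_tsum (a, b))
    rw [hW, hE, hω, hξ]
  have hWpos : 0 < W := by positivity
  have hle : W * Real.exp E ≤ (Sconst H lam w).toReal ^ lam := by
    rw [ENNReal.toReal_rpow]
    exact (ENNReal.ofReal_le_iff_le_toReal
      (ENNReal.rpow_ne_top_of_nonneg hlam.le hS.ne)).1 hterm
  have hSpos : 0 < (Sconst H lam w).toReal := by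
    rcases ENNReal.toReal_nonneg.eq_or_lt with h | h
    · rw [← h, Real.zero_rpow hlam.ne'] at hle
      exact absurd hle (not_le.2 (by positivity))
    · exact h
  have hlog := Real.log_le_log (by positivity) hle
  rw [Real.log_mul hWpos.ne' (Real.exp_pos _).ne', Real.log_exp, Real.log_rpow hSpos, hW,
    Real.log_mul (by positivity) (by positivity), Real.log_mul (by positivity) (by positivity),
    Real.log_rpow two_pos, Real.log_rpow hω0, Real.log_rpow hξ0] at hlog
  linarith

/-- Jensen's inequality for the exponential moment `Rconst`. -/
lemma integral_norm_sq_le_log_Rconst {d : ℕ} {lam : ℝ} (hlam : 0 < lam) {w : ℝ → Euc d}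
    (hw : ContinuousOn w (Set.Icc 0 1)) :
    ∫ u in (0 : ℝ)..1, ‖w u‖ ^ 2 ≤ Real.log (Rconst lam w).toReal := by
  set μ : Measure ℝ := volume.restrict (Set.Icc (0 : ℝ) 1) with hμ
  have : IsProbabilityMeasure μ := ⟨by simp [hμ]⟩
  have hc : ContinuousOn (fun u => lam * ‖w u‖ ^ 2) (Set.Icc 0 1) := by fun_prop
  have hi : Integrable (fun u => lam * ‖w u‖ ^ 2) μ := hc.integrableOn_Icc
  have hie : Integrable (fun u => Real.exp (lam * ‖w u‖ ^ 2)) μ :=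
    (Real.continuous_exp.comp_continuousOn hc).integrableOn_Icc
  have hJ : Real.exp (∫ u, lam * ‖w u‖ ^ 2 ∂μ) ≤ ∫ u, Real.exp (lam * ‖w u‖ ^ 2) ∂μ :=
    convexOn_exp.map_integral_le Real.continuous_exp.continuousOn isClosed_univ (by simp) hi hie
  have hpos := (Real.exp_pos _).trans_le hJ
  have hR : (Rconst lam w).toReal = (∫ u, Real.exp (lam * ‖w u‖ ^ 2) ∂μ) ^ (1 / lam) := by
    rw [Rconst, ← ofReal_integral_eq_lintegral_ofReal hie
      (ae_of_all _ fun _ => (Real.exp_pos _).le), ← ENNReal.toReal_rpow,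
      ENNReal.toReal_ofReal hpos.le]
  have hlog := (Real.le_log_iff_exp_le hpos).2 hJ
  rw [integral_const_mul] at hlog
  rw [hR, Real.log_rpow hpos, intervalIntegral.integral_of_le zero_le_one,
    ← integral_Icc_eq_integral_Ioc, one_div, inv_mul_eq_div, le_div_iff₀ hlam]
  linarith

lemma le_sq_sqrt (x : ℝ) : x ≤ √x ^ 2 := by
  rcases le_total 0 x with h | h
  · rw [Real.sq_sqrt h]
  · exact h.trans (sq_nonneg _)

lemma integral_norm_le_sqrt_mul {d : ℕ} {lam : ℝ} (hlam : 0 < lam) {w : ℝ → Euc d}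
    (hw : ContinuousOn w (Set.Icc 0 1)) {a b : ℝ} (ha : 0 ≤ a) (hab : a < b) (hb : b ≤ 1) :
    ∫ u in a..b, ‖w u‖ ≤ √(b - a) * (√(Real.log (Rconst lam w).toReal) + 1) := by
  set ρ : ℝ := √(Real.log (Rconst lam w).toReal) with hρ
  set δ : ℝ := √(b - a) with hδ
  have hρ0 : 0 ≤ ρ := Real.sqrt_nonneg _
  have hδ0 : 0 < δ := Real.sqrt_pos.2 (sub_pos.2 hab)
  have hδ2 : δ ^ 2 = b - a := Real.sq_sqrt (sub_pos.2 hab).le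
  have hsub : Set.uIcc a b ⊆ Set.Icc 0 1 := by
    rw [Set.uIcc_of_le hab.le]; exact Set.Icc_subset_Icc ha hb
  have hwab : ContinuousOn w (Set.uIcc a b) := hw.mono hsub
  have hi2 : IntervalIntegrable (fun u => ‖w u‖ ^ 2) volume a b :=
    ContinuousOn.intervalIntegrable (by fun_prop)
  have hsq : ∫ u in a..b, ‖w u‖ ^ 2 ≤ ρ ^ 2 := by
    calc ∫ u in a..b, ‖w u‖ ^ 2 ≤ ∫ u in (0 : ℝ)..1, ‖w u‖ ^ 2 := by
          apply intervalIntegral.integral_mono_interval ha hab.le hb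
          · exact ae_of_all _ fun u => by positivity
          · apply ContinuousOn.intervalIntegrable
            rw [Set.uIcc_of_le zero_le_one]
            fun_prop
      _ ≤ Real.log (Rconst lam w).toReal := integral_norm_sq_le_log_Rconst hlam hw
      _ ≤ ρ ^ 2 := le_sq_sqrt _
  set c : ℝ := δ / (ρ + 1) with hc
  have hc0 : 0 < c := by positivity
  have hmono : ∫ u in a..b, ‖w u‖ ≤ ∫ u in a..b, (c⁻¹ + c * ‖w u‖ ^ 2) / 2 := by
    apply intervalIntegral.integral_mono_on hab.le
    · exact ContinuousOn.intervalIntegrable (by fun_prop)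
    · exact ContinuousOn.intervalIntegrable (by fun_prop)
    · intro u _
      have h1 : 0 ≤ c * (c⁻¹ - ‖w u‖) ^ 2 := by positivity
      have h2 : c * (c⁻¹ - ‖w u‖) ^ 2 = c⁻¹ + c * ‖w u‖ ^ 2 - 2 * ‖w u‖ := by
        field_simp
        ring
      linarith
  rw [intervalIntegral.integral_div, intervalIntegral.integral_add (by simp)
    (hi2.const_mul _), intervalIntegral.integral_const, intervalIntegral.integral_const_mul,
    smul_eq_mul, ← hδ2] at hmono
  have h1 : δ ^ 2 * c⁻¹ = δ * (ρ + 1) := by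
    rw [hc]; field_simp
  have h2 : c * ∫ u in a..b, ‖w u‖ ^ 2 ≤ δ * (ρ + 1) := by
    calc c * ∫ u in a..b, ‖w u‖ ^ 2 ≤ c * (ρ + 1) ^ 2 := by
          gcongr
          nlinarith
      _ = δ * (ρ + 1) := by rw [hc]; field_simp
  linarith

lemma norm_exp_I_mul_sub_exp_I_mul_le (x y : ℝ) :
    ‖Complex.exp (Complex.I * (x : ℂ)) - Complex.exp (Complex.I * (y : ℂ))‖ ≤ |x - y| := by
  have h : Complex.exp (Complex.I * (x : ℂ)) - Complex.exp (Complex.I * (y : ℂ)) =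
      Complex.exp (Complex.I * (y : ℂ)) * (Complex.exp (Complex.I * ((x - y : ℝ) : ℂ)) - 1) := by
    rw [mul_sub, ← Complex.exp_add, mul_one]
    congr 2
    push_cast
    ring
  rw [h, norm_mul, mul_comm Complex.I, Complex.norm_exp_ofReal_mul_I, one_mul]
  exact Real.norm_exp_I_mul_ofReal_sub_one_le

lemma intervalIntegrable_Yint_integrand {d : ℕ} {w : ℝ → Euc d}
    (hw : ContinuousOn w (Set.Icc 0 1)) {a b : ℝ} (ha : a ∈ Set.Icc (0 : ℝ) 1)
    (hb : b ∈ Set.Icc (0 : ℝ) 1) (ω : ℝ) (ξ : Euc d) :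
    IntervalIntegrable
      (fun u => Complex.exp (Complex.I * Complex.ofReal (inner ℝ ξ (w u) + ω * u)))
      volume a b := by
  have hwab : ContinuousOn w (Set.uIcc a b) := hw.mono (Set.uIcc_subset_Icc ha hb)
  exact ContinuousOn.intervalIntegrable (by fun_prop)

/-- Dependence of `Yint` on the frequency. -/
lemma norm_Yint_sub_le {d : ℕ} {w : ℝ → Euc d} (hw : ContinuousOn w (Set.Icc 0 1)) {a b : ℝ}
    (ha : 0 ≤ a) (hab : a ≤ b) (hb : b ≤ 1) (ω ω' : ℝ) (ξ ξ' : Euc d) :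
    ‖Yint w a b ω ξ - Yint w a b ω' ξ'‖ ≤
      ‖ξ - ξ'‖ * (∫ u in a..b, ‖w u‖) + |ω - ω'| * (b - a) := by
  have ha' : a ∈ Set.Icc (0 : ℝ) 1 := ⟨ha, hab.trans hb⟩
  have hb' : b ∈ Set.Icc (0 : ℝ) 1 := ⟨ha.trans hab, hb⟩
  have hwab : ContinuousOn w (Set.uIcc a b) := hw.mono (Set.uIcc_subset_Icc ha' hb')
  have hi : IntervalIntegrable (fun u => ‖ξ - ξ'‖ * ‖w u‖) volume a b :=
    ContinuousOn.intervalIntegrable (by fun_prop)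
  rw [Yint, Yint, ← intervalIntegral.integral_sub
    (intervalIntegrable_Yint_integrand hw ha' hb' ω ξ)
    (intervalIntegrable_Yint_integrand hw ha' hb' ω' ξ')]
  have key := intervalIntegral.norm_integral_le_of_norm_le (μ := volume) hab
    (f := fun u => Complex.exp (Complex.I * Complex.ofReal (inner ℝ ξ (w u) + ω * u)) -
      Complex.exp (Complex.I * Complex.ofReal (inner ℝ ξ' (w u) + ω' * u)))
    (g := fun u => ‖ξ - ξ'‖ * ‖w u‖ + |ω - ω'|) (ae_of_all _ fun u hu => ?_)
    (hi.add (by simp))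
  · rw [intervalIntegral.integral_add hi (by simp), intervalIntegral.integral_const_mul,
      intervalIntegral.integral_const, smul_eq_mul] at key
    linarith
  · refine (norm_exp_I_mul_sub_exp_I_mul_le _ _).trans ?_
    have e : inner ℝ ξ (w u) + ω * u - (inner ℝ ξ' (w u) + ω' * u) =
        inner ℝ (ξ - ξ') (w u) + (ω - ω') * u := by
      rw [inner_sub_left]; ring
    have hu1 : |u| ≤ 1 := abs_le.2 ⟨by linarith [hu.1], by linarith [hu.2]⟩
    rw [e]
    refine (abs_add_le _ _).trans (add_le_add (abs_real_inner_le_norm _ _) ?_)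
    rw [abs_mul]
    exact mul_le_of_le_one_right (abs_nonneg _) hu1

lemma sqrt_log_le_add_sqrt_log {x y c : ℝ} (hx : 0 < x) (hy : 1 ≤ y) (hc : 1 ≤ c)
    (h : x ≤ c * y) : √(Real.log x) ≤ c + √(Real.log y) := by
  have hy0 : 0 ≤ Real.log y := Real.log_nonneg hy
  rw [Real.sqrt_le_left (by positivity)]
  have h1 : Real.log x ≤ Real.log c + Real.log y := by
    rw [← Real.log_mul (by positivity) (by positivity)]
    exact Real.log_le_log hx h
  have h2 : Real.log c ≤ c - 1 := Real.log_le_sub_one_of_pos (by positivity)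
  nlinarith [Real.sq_sqrt hy0, Real.sqrt_nonneg (Real.log y)]

/-- Every frequency lies close to the grid `2⁻ᵐℤ × (2⁻ᵐℤ)ᵈ`. -/
lemma exists_grid_near {d : ℕ} (m : ℕ) (ω : ℝ) (ξ : Euc d) :
    ∃ (a : ℤ) (b : Fin d → ℤ), |ω - (a : ℝ) / 2 ^ m| ≤ (1 / 2) ^ m ∧
      ‖ξ - (EuclideanSpace.equiv (Fin d) ℝ).symm (fun i => (b i : ℝ) / 2 ^ m)‖ ≤
        d * (1 / 2) ^ m := by
  have hfloor : ∀ x : ℝ, |x - (⌊x * 2 ^ m⌋ : ℝ) / 2 ^ m| ≤ (1 / 2) ^ m := by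
    intro x
    have hp : (0 : ℝ) < 2 ^ m := by positivity
    have h1 := Int.floor_le (x * 2 ^ m)
    have h2 := Int.lt_floor_add_one (x * 2 ^ m)
    have e : x - (⌊x * 2 ^ m⌋ : ℝ) / 2 ^ m = (x * 2 ^ m - ⌊x * 2 ^ m⌋) / 2 ^ m := by
      field_simp
    rw [e, abs_div, abs_of_pos hp, one_div_pow]
    gcongr
    exact abs_le.2 ⟨by linarith, by linarith⟩
  refine ⟨⌊ω * 2 ^ m⌋, fun i => ⌊ξ i * 2 ^ m⌋, hfloor ω, ?_⟩
  rw [EuclideanSpace.norm_eq, Real.sqrt_le_left (by positivity)]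
  calc ∑ i, ‖(ξ - (EuclideanSpace.equiv (Fin d) ℝ).symm
          (fun i => (⌊ξ i * 2 ^ m⌋ : ℝ) / 2 ^ m)) i‖ ^ 2
      ≤ ∑ _i : Fin d, ((1 / 2 : ℝ) ^ m) ^ 2 := by
        refine Finset.sum_le_sum fun i _ => ?_
        gcongr
        simpa using hfloor (ξ i)
    _ = d * ((1 / 2 : ℝ) ^ m) ^ 2 := by simp
    _ ≤ (d * (1 / 2) ^ m) ^ 2 := by
        rw [mul_pow]
        gcongr
        exact_mod_cast Nat.le_self_pow two_ne_zero d

/-- `Yint` on a dyadic interval at a grid frequency, in square-root form. -/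
lemma rpow_mul_norm_Yint_grid_le {d : ℕ} {H lam : ℝ} (hlam : 0 < lam)
    (hlam1 : lam ≤ 1) {w : ℝ → Euc d} (hS : Sconst H lam w < ⊤) (n m : ℕ) {k : ℕ}
    (hk : k < 2 ^ n) (a : ℤ) (b : Fin d → ℤ) {ω : ℝ} {ξ : Euc d} (hω : ω = (a : ℝ) / 2 ^ m)
    (hξ : ξ = (EuclideanSpace.equiv (Fin d) ℝ).symm (fun i => (b i : ℝ) / 2 ^ m)) :
    (1 + ‖ξ‖) ^ (1 / (2 * H)) * ‖Yint w ((k : ℝ) / 2 ^ n) (((k : ℝ) + 1) / 2 ^ n) ω ξ‖ ≤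
      √(1 / 2) ^ n * ((d + 4) / lam * (√(Real.log (Sconst H lam w).toReal) + √(n : ℝ) +
        √(m : ℝ) + √(Real.log (1 + |ω|)) + √(Real.log (1 + ‖ξ‖)))) := by
  have hgrid := Yint_grid_bound hlam hS n m hk a b hω hξ
  set y := ‖Yint w ((k : ℝ) / 2 ^ n) (((k : ℝ) + 1) / 2 ^ n) ω ξ‖ with hy
  have hξ0 : 0 < 1 + ‖ξ‖ := by positivity
  have hpow : (1 + ‖ξ‖) ^ (1 / H) = ((1 + ‖ξ‖) ^ (1 / (2 * H))) ^ 2 := by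
    rw [← Real.rpow_natCast, ← Real.rpow_mul hξ0.le]
    congr 1
    push_cast
    field_simp
  set z := (1 + ‖ξ‖) ^ (1 / (2 * H)) with hz
  have hS' := le_sq_sqrt (Real.log (Sconst H lam w).toReal)
  have hn' := Real.sq_sqrt (Nat.cast_nonneg (α := ℝ) n)
  have hm' := Real.sq_sqrt (Nat.cast_nonneg (α := ℝ) m)
  have hω' := le_sq_sqrt (Real.log (1 + |ω|))
  have hξ' := le_sq_sqrt (Real.log (1 + ‖ξ‖))
  have pS := Real.sqrt_nonneg (Real.log (Sconst H lam w).toReal)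
  have pn := Real.sqrt_nonneg (n : ℝ)
  have pm := Real.sqrt_nonneg (m : ℝ)
  have pω := Real.sqrt_nonneg (Real.log (1 + |ω|))
  have pξ := Real.sqrt_nonneg (Real.log (1 + ‖ξ‖))
  set σ := √(Real.log (Sconst H lam w).toReal)
  set N := √(n : ℝ)
  set M := √(m : ℝ)
  set U := √(Real.log (1 + |ω|))
  set V := √(Real.log (1 + ‖ξ‖))
  have hd0 : (0 : ℝ) ≤ d := Nat.cast_nonneg d
  have hl0 : 0 ≤ Real.log 2 := Real.log_nonneg (by norm_num)
  have hl1 : Real.log 2 ≤ 1 := by linarith [Real.log_two_lt_d9]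
  have hrhs : lam * 2 ^ n * z ^ 2 * y ^ 2 ≤ (d + 4) * (σ + N + M + U + V) ^ 2 := by
    rw [hpow] at hgrid
    have t1 : lam * Real.log (Sconst H lam w).toReal ≤ (d + 4) * σ ^ 2 := by
      calc lam * Real.log (Sconst H lam w).toReal ≤ lam * σ ^ 2 := by gcongr
        _ ≤ (d + 4) * σ ^ 2 := by gcongr; linarith
    have t2 : (2 * (n : ℝ) + m * (d + 2)) * Real.log 2 ≤ (d + 4) * (N ^ 2 + M ^ 2) := by
      calc (2 * (n : ℝ) + m * (d + 2)) * Real.log 2 ≤ (2 * (n : ℝ) + m * (d + 2)) * 1 := by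
            gcongr
        _ ≤ (d + 4) * (N ^ 2 + M ^ 2) := by
            rw [hn', hm']
            nlinarith [Nat.cast_nonneg (α := ℝ) n, Nat.cast_nonneg (α := ℝ) m,
              mul_nonneg hd0 (Nat.cast_nonneg (α := ℝ) n)]
    have t3 : 2 * Real.log (1 + |ω|) ≤ (d + 4) * U ^ 2 := by nlinarith [sq_nonneg U]
    have t4 : (d + 1) * Real.log (1 + ‖ξ‖) ≤ (d + 4) * V ^ 2 := by
      calc (d + 1) * Real.log (1 + ‖ξ‖) ≤ (d + 1) * V ^ 2 := by gcongr
        _ ≤ (d + 4) * V ^ 2 := by gcongr; norm_num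
    have t5 : σ ^ 2 + (N ^ 2 + M ^ 2) + U ^ 2 + V ^ 2 ≤ (σ + N + M + U + V) ^ 2 := by
      have : 0 ≤ 2 * (σ * (N + M + U + V) + N * (M + U + V) + M * (U + V) + U * V) := by
        positivity
      nlinarith
    have t6 := mul_le_mul_of_nonneg_left t5 (by positivity : (0 : ℝ) ≤ d + 4)
    linarith
  set G := σ + N + M + U + V
  have hG0 : 0 ≤ G := by positivity
  have hr2 : (√(1 / 2 : ℝ) ^ n) ^ 2 * 2 ^ n = 1 := by
    rw [← pow_mul, mul_comm n 2, pow_mul, Real.sq_sqrt (by norm_num), ← mul_pow]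
    norm_num
  have hc1 : 1 ≤ (d + 4) / lam := by
    rw [le_div_iff₀ hlam]; linarith
  have hz2 : 2 ^ n * (z * y) ^ 2 ≤ ((d + 4) / lam * G) ^ 2 := by
    calc 2 ^ n * (z * y) ^ 2 = lam * 2 ^ n * z ^ 2 * y ^ 2 / lam := by field_simp
      _ ≤ (d + 4) * G ^ 2 / lam := by gcongr
      _ = (d + 4) / lam * 1 * G ^ 2 := by ring
      _ ≤ (d + 4) / lam * ((d + 4) / lam) * G ^ 2 := by gcongr
      _ = ((d + 4) / lam * G) ^ 2 := by ring
  refine le_of_sq_le_sq ?_ (by positivity)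
  calc (z * y) ^ 2 = (√(1 / 2 : ℝ) ^ n) ^ 2 * (2 ^ n * (z * y) ^ 2) := by
        rw [← mul_assoc, hr2, one_mul]
    _ ≤ (√(1 / 2 : ℝ) ^ n) ^ 2 * ((d + 4) / lam * G) ^ 2 := by gcongr
    _ = _ := by ring

/-- A dyadic scale below `X⁻ᵖ` whose index grows at most like `log X`. -/
lemma exists_dyadic_scale {p X : ℝ} (hp0 : 0 < p) (hX1 : 1 ≤ X) :
    ∃ m : ℕ, X ^ p * (1 / 2) ^ m ≤ 1 ∧ √(m : ℝ) ≤ 1 + (1 + 2 * p) * √(Real.log X) := by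
  have hX0 : 0 < X := by linarith
  have hlX : 0 ≤ Real.log X := Real.log_nonneg hX1
  have hl2 : 0 < Real.log 2 := Real.log_pos (by norm_num)
  refine ⟨⌈p * Real.log X / Real.log 2⌉₊, ?_, ?_⟩
  · have h := Nat.le_ceil (p * Real.log X / Real.log 2)
    rw [div_le_iff₀ hl2] at h
    rw [one_div_pow, mul_one_div, div_le_one (by positivity),
      ← Real.log_le_log_iff (by positivity) (by positivity), Real.log_rpow hX0, Real.log_pow]
    exact h
  · have h := (Nat.ceil_lt_add_one
      (by positivity : 0 ≤ p * Real.log X / Real.log 2)).le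
    have h2 : p * Real.log X / Real.log 2 ≤ 2 * p * Real.log X := by
      rw [div_le_iff₀ hl2]
      have := mul_nonneg hp0.le hlX
      nlinarith [Real.log_two_gt_d9]
    rw [Real.sqrt_le_left (by positivity)]
    refine (h.trans (add_le_add_left h2 1)).trans ?_
    have hs := Real.sq_sqrt hlX
    have hs0 := Real.sqrt_nonneg (Real.log X)
    have e1 : 0 ≤ p * √(Real.log X) := by positivity
    have e2 : 0 ≤ p * √(Real.log X) ^ 2 := by positivity
    nlinarith [sq_nonneg (p * √(Real.log X))]

/-- Control of `Yint` on dyadic intervals for arbitrary frequencies. -/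
lemma norm_Yint_dyadic_le {d : ℕ} {H lam : ℝ} (hH : 0 < H) (hlam : 0 < lam)
    (hlam1 : lam ≤ 1) {w : ℝ → Euc d} (hw : ContinuousOn w (Set.Icc 0 1))
    (hS : Sconst H lam w < ⊤) (n : ℕ) {k : ℕ} (hk : k < 2 ^ n) (ω : ℝ) (ξ : Euc d) :
    ‖Yint w ((k : ℝ) / 2 ^ n) (((k : ℝ) + 1) / 2 ^ n) ω ξ‖ ≤
      ((1 + d : ℝ) ^ (1 / (2 * H)) * ((d + 4) / lam) * (1 + d + 2 * (1 / (2 * H))) + d + 1) *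
        (1 + ‖ξ‖) ^ (-(1 / (2 * H))) * (√(1 / 2) ^ n *
          (4 * (1 + Qconst H lam w + √(Real.log (1 + |ω|)) + √(Real.log (1 + ‖ξ‖))) +
            √(n : ℝ))) := by
  have hp0 : 0 < 1 / (2 * H) := by positivity
  set X : ℝ := 1 + ‖ξ‖ with hX
  have hX1 : 1 ≤ X := by rw [hX]; linarith [norm_nonneg ξ]
  have hX0 : 0 < X := by linarith
  have hd0 : (0 : ℝ) ≤ d := Nat.cast_nonneg d
  obtain ⟨m, hm1, hm2⟩ := exists_dyadic_scale hp0 hX1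
  obtain ⟨a, b, ha, hb⟩ := exists_grid_near m ω ξ
  obtain ⟨ω', hω'⟩ : ∃ ω' : ℝ, ω' = (a : ℝ) / 2 ^ m := ⟨_, rfl⟩
  obtain ⟨ξ', hξ'⟩ : ∃ ξ' : Euc d, ξ' = (EuclideanSpace.equiv (Fin d) ℝ).symm
    (fun i => (b i : ℝ) / 2 ^ m) := ⟨_, rfl⟩
  rw [← hω'] at ha
  rw [← hξ'] at hb
  have hgrid := rpow_mul_norm_Yint_grid_le hlam hlam1 hS n m hk a b hω' hξ'
  have hη0 : (0 : ℝ) < (1 / 2) ^ m := by positivity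
  have hη1 : (1 / 2 : ℝ) ^ m ≤ 1 := pow_le_one₀ (by norm_num) (by norm_num)
  have hξξ : ‖ξ - ξ'‖ ≤ d := hb.trans (mul_le_of_le_one_right hd0 hη1)
  have hUle : √(Real.log (1 + |ω'|)) ≤ 2 + √(Real.log (1 + |ω|)) := by
    apply sqrt_log_le_add_sqrt_log (by positivity) (by linarith [abs_nonneg ω]) (by norm_num)
    have := abs_sub_abs_le_abs_sub ω' ω
    rw [abs_sub_comm] at this
    linarith [abs_nonneg ω]
  have hVle : √(Real.log (1 + ‖ξ'‖)) ≤ (1 + d) + √(Real.log X) := by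
    apply sqrt_log_le_add_sqrt_log (by positivity) hX1 (by linarith)
    have := norm_sub_norm_le ξ' ξ
    rw [norm_sub_rev] at this
    nlinarith [mul_nonneg hd0 (norm_nonneg ξ)]
  have hXX : X ^ (1 / (2 * H)) ≤ (1 + d : ℝ) ^ (1 / (2 * H)) * (1 + ‖ξ'‖) ^ (1 / (2 * H)) := by
    rw [← Real.mul_rpow (by positivity) (by positivity)]
    apply Real.rpow_le_rpow hX0.le _ hp0.le
    have := norm_sub_norm_le ξ ξ'
    nlinarith [mul_nonneg hd0 (norm_nonneg ξ')]
  have hkn : ((k : ℝ) + 1) / 2 ^ n ≤ 1 := by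
    rw [div_le_one (by positivity)]
    exact_mod_cast hk
  have hlen : ((k : ℝ) + 1) / 2 ^ n - (k : ℝ) / 2 ^ n = (√(1 / 2 : ℝ) ^ n) ^ 2 := by
    rw [← pow_mul, mul_comm n 2, pow_mul, Real.sq_sqrt (by norm_num), one_div_pow]
    ring
  have hr0 : 0 < √(1 / 2 : ℝ) ^ n := by positivity
  have hr1 : √(1 / 2 : ℝ) ^ n ≤ 1 :=
    pow_le_one₀ (Real.sqrt_nonneg _) (Real.sqrt_le_one.2 (by norm_num))
  have hlt : (k : ℝ) / 2 ^ n < ((k : ℝ) + 1) / 2 ^ n := by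
    rw [← sub_pos, hlen]; positivity
  have hdiff := norm_Yint_sub_le hw (by positivity) hlt.le hkn ω ω' ξ ξ'
  have hint := integral_norm_le_sqrt_mul hlam hw (by positivity) hlt hkn
  rw [hlen, Real.sqrt_sq hr0.le] at hint
  rw [hlen] at hdiff
  set Y := Yint w ((k : ℝ) / 2 ^ n) (((k : ℝ) + 1) / 2 ^ n) ω ξ
  set Y' := Yint w ((k : ℝ) / 2 ^ n) (((k : ℝ) + 1) / 2 ^ n) ω' ξ'
  set r := √(1 / 2 : ℝ) ^ n
  rw [Qconst]
  have pS := Real.sqrt_nonneg (Real.log (Sconst H lam w).toReal)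
  have pR := Real.sqrt_nonneg (Real.log (Rconst lam w).toReal)
  have pn := Real.sqrt_nonneg (n : ℝ)
  have pU := Real.sqrt_nonneg (Real.log (1 + |ω|))
  have pV := Real.sqrt_nonneg (Real.log X)
  set σ := √(Real.log (Sconst H lam w).toReal)
  set ρ := √(Real.log (Rconst lam w).toReal)
  set N := √(n : ℝ)
  set U := √(Real.log (1 + |ω|))
  set V := √(Real.log X)
  set T := 4 * (1 + (σ + ρ) + U + V) + N with hT
  have hXp : 0 < X ^ (1 / (2 * H)) := by positivity
  set p := 1 / (2 * H)
  have hG : σ + N + √(m : ℝ) + √(Real.log (1 + |ω'|)) + √(Real.log (1 + ‖ξ'‖)) ≤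
      (1 + d + 2 * p) * T := by
    have e1 : (d : ℝ) * 1 ≤ d * T := mul_le_mul_of_nonneg_left (by linarith) hd0
    have e2 : 2 * p * V ≤ 2 * p * T := mul_le_mul_of_nonneg_left (by linarith) (by positivity)
    linarith
  have hmain : X ^ p * ‖Y'‖ ≤ (1 + d : ℝ) ^ p * ((d + 4) / lam) * (1 + d + 2 * p) * (r * T) := by
    calc X ^ p * ‖Y'‖ ≤ (1 + d : ℝ) ^ p * (1 + ‖ξ'‖) ^ p * ‖Y'‖ := by gcongr
      _ = (1 + d : ℝ) ^ p * ((1 + ‖ξ'‖) ^ p * ‖Y'‖) := by ring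
      _ ≤ (1 + d : ℝ) ^ p * (r * ((d + 4) / lam * ((1 + d + 2 * p) * T))) := by
        refine mul_le_mul_of_nonneg_left (hgrid.trans ?_) (by positivity)
        gcongr
      _ = _ := by ring
  have hrem : X ^ p * ‖Y - Y'‖ ≤ (d + 1) * (r * T) := by
    have h1 : ‖Y - Y'‖ ≤ (1 / 2) ^ m * ((d + 1) * (r * (ρ + 1))) := by
      calc ‖Y - Y'‖ ≤ _ := hdiff
        _ ≤ d * (1 / 2) ^ m * (r * (ρ + 1)) + (1 / 2) ^ m * (r * 1) := by
          rw [sq]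
          have hI : 0 ≤ ∫ u in (k : ℝ) / 2 ^ n..((k : ℝ) + 1) / 2 ^ n, ‖w u‖ :=
            intervalIntegral.integral_nonneg hlt.le fun u _ => norm_nonneg _
          gcongr
        _ ≤ d * (1 / 2) ^ m * (r * (ρ + 1)) + (1 / 2) ^ m * (r * (ρ + 1)) := by
          gcongr
          linarith
        _ = _ := by ring
    calc X ^ p * ‖Y - Y'‖ ≤ X ^ p * ((1 / 2) ^ m * ((d + 1) * (r * (ρ + 1)))) := by gcongr
      _ = (X ^ p * (1 / 2) ^ m) * ((d + 1) * (r * (ρ + 1))) := by ring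
      _ ≤ 1 * ((d + 1) * (r * T)) := by
        gcongr
        linarith
      _ = _ := one_mul _
  have htri : ‖Y‖ ≤ ‖Y'‖ + ‖Y - Y'‖ := norm_le_norm_add_norm_sub' Y Y'
  rw [Real.rpow_neg hX0.le]
  rw [mul_right_comm, ← div_eq_mul_inv, le_div_iff₀ hXp]
  linarith [mul_le_mul_of_nonneg_left htri hXp.le]

/-- Pathwise bound on the oscillatory integral `Y^w`:
`|Y^w_{s,t}(ω,ξ)| ≤ C √(t−s) (1+|ξ|)^{−1/(2H)} (1 + Q^w_λ + √|log(t−s)| +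
√log(1+|ω|) + √log(1+|ξ|))` with `C = C(H,d,λ)`. -/
theorem statement14 (d : ℕ) (hd : 1 ≤ d) (H lam : ℝ) (hH : 0 < H)
    (hlam : 0 < lam) (hlam1 : lam ≤ 1) :
    ∃ C : ℝ, 0 < C ∧ ∀ w : ℝ → Euc d, ContinuousOn w (Set.Icc 0 1) →
      Rconst lam w < ⊤ → Sconst H lam w < ⊤ →
      ∀ s t : ℝ, 0 ≤ s → s < t → t ≤ 1 → ∀ (ω : ℝ) (ξ : Euc d),
        ‖Yint w s t ω ξ‖ ≤
          C * Real.sqrt (t - s) * (1 + ‖ξ‖) ^ (-(1 / (2 * H))) *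
            (1 + Qconst H lam w + Real.sqrt |Real.log (t - s)| +
              Real.sqrt (Real.log (1 + |ω|)) + Real.sqrt (Real.log (1 + ‖ξ‖))) := by
  have hp0 : 0 < 1 / (2 * H) := by positivity
  set K₀ : ℝ := (1 + d : ℝ) ^ (1 / (2 * H)) * ((d + 4) / lam) * (1 + d + 2 * (1 / (2 * H))) +
    d + 1 with hK₀
  have hK₀pos : 0 < K₀ := by positivity
  refine ⟨336 * K₀, by positivity, ?_⟩
  intro w hw _ hS s t hs0 hst ht1 ω ξ
  have hQ0 : 0 ≤ Qconst H lam w := add_nonneg (Real.sqrt_nonneg _) (Real.sqrt_nonneg _)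
  have hsub : ∀ a b : ℝ, 0 ≤ a → a ≤ b → b ≤ 1 →
      Yint w 0 b ω ξ - Yint w 0 a ω ξ = Yint w a b ω ξ := fun a b ha hab hb =>
    intervalIntegral.integral_interval_sub_left
      (intervalIntegrable_Yint_integrand hw (by simp) ⟨ha.trans hab, hb⟩ ω ξ)
      (intervalIntegrable_Yint_integrand hw (by simp) ⟨ha, hab.trans hb⟩ ω ξ)
  set L : ℝ := 1 + Qconst H lam w + √(Real.log (1 + |ω|)) + √(Real.log (1 + ‖ξ‖)) with hL
  have hL1 : 1 ≤ L := by
    have := Real.sqrt_nonneg (Real.log (1 + |ω|))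
    have := Real.sqrt_nonneg (Real.log (1 + ‖ξ‖))
    linarith
  have hchain := norm_sub_le_of_dyadic (F := fun u => Yint w 0 u ω ξ) (A := 4 * L)
    (K := K₀ * (1 + ‖ξ‖) ^ (-(1 / (2 * H)))) (by linarith) (by positivity)
    (fun a b ha hab hb => by
      rw [hsub a b ha hab hb, Yint]
      have := intervalIntegral.norm_integral_le_of_norm_le_const (a := a) (b := b) (C := 1)
        (f := fun u => Complex.exp (Complex.I * Complex.ofReal (inner ℝ ξ (w u) + ω * u)))
        (fun u _ => by rw [mul_comm, Complex.norm_exp_ofReal_mul_I])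
      rwa [one_mul, abs_of_nonneg (sub_nonneg.2 hab)] at this)
    (fun n k hk => by
      rw [hsub _ _ (by positivity) (by gcongr; linarith)
        (by rw [div_le_one (by positivity)]; exact_mod_cast hk)]
      exact norm_Yint_dyadic_le hH hlam hlam1 hw hS n hk ω ξ)
    hs0 hst ht1
  rw [hsub s t hs0 hst.le ht1] at hchain
  refine hchain.trans ?_
  calc 84 * (K₀ * (1 + ‖ξ‖) ^ (-(1 / (2 * H)))) * √(t - s) * (4 * L + √|Real.log (t - s)|)
      ≤ 84 * (K₀ * (1 + ‖ξ‖) ^ (-(1 / (2 * H)))) * √(t - s) *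
          (4 * (L + √|Real.log (t - s)|)) := by
        gcongr
        linarith [Real.sqrt_nonneg |Real.log (t - s)|]
    _ = _ := by rw [hL]; ring

end
end
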